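/- Let M be a conformal representation of an n-Lie conformal algebra R. Then the ℂ[∂]-module R ⊕ M is an n-Lie conformal algebra under the bracket [(a¹+v¹)_{λ₁}⋯_{λ_{n-1}}(aⁿ+vⁿ)] = [a¹_{λ₁}⋯_{λ_{n-1}}aⁿ] + Σ_{i=1}^{n-1}(−1)^{n−i} a¹_{λ₁}⋯âⁱ⋯_{λ_{n-1}}aⁿ_{−∂−Σλⱼ} vⁱ + a¹_{λ₁}⋯a^{n-1}_{λ_{n-1}} vⁿ (semidirect product). -/

import Mathlib

noncomputable section

open Finset

/-- The index `n - 2` (position of `λ_{n-1}`, the last conformal weight) in `Fin m`,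
where `m = n - 1`. -/
def lastIdx (m : ℕ) [NeZero m] : Fin m :=
  ⟨m - 1, Nat.sub_lt (Nat.pos_of_ne_zero (NeZero.ne m)) Nat.one_pos⟩

/-- Divided power `z^(k) = z^k / k!`. -/
def dPow (z : ℂ) (k : ℕ) : ℂ := z ^ k / (k.factorial : ℂ)

variable {m : ℕ} [NeZero m] {R : Type*} [AddCommGroup R] [Module ℂ R]

/-- Evaluation of the `{λ₁,…,λ_{n-1}}`-bracket
`[x¹ _{λ₁} ⋯ _{λ_{n-1}} x^n] = Σ_k λ₁^(k₁)⋯λ_{n-1}^(k_{n-1}) x¹_{(k₁)}⋯_{(k_{n-1})}x^n`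
at complex values of the `λ`'s (here `m = n - 1`). -/
def pEval (prodl : (Fin m → ℕ) → MultilinearMap ℂ (fun _ : Fin (m + 1) => R) R)
    (lam : Fin m → ℂ) (x : Fin (m + 1) → R) : R :=
  ∑ᶠ k : Fin m → ℕ, (∏ s, dPow (lam s) (k s)) • prodl k x

/-- Evaluation of the bracket where the last conformal weight `λ_{n-1}` is replaced by the
operator `−∂ − c` (divided-power substitution), as needed for the conformal
skew-symmetry in the last slot. -/
def pEvalOp (D : Module.End ℂ R)
    (prodl : (Fin m → ℕ) → MultilinearMap ℂ (fun _ : Fin (m + 1) => R) R)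
    (lam : Fin m → ℂ) (c : ℂ) (x : Fin (m + 1) → R) : R :=
  ∑ᶠ k : Fin m → ℕ,
    (∏ s ∈ Finset.univ.erase (lastIdx m), dPow (lam s) (k s)) •
      (((k (lastIdx m)).factorial : ℂ)⁻¹ •
        ((-(D + c • (1 : Module.End ℂ R))) ^ (k (lastIdx m))) (prodl k x))

/-- An `n`-Lie conformal algebra with `n = m + 1`: a `ℂ[∂]`-module (a complex vector
space `R` together with the action `D` of `∂`) with `n`-ary `k`-products
`x¹_{(k₁)}⋯_{(k_{n-1})}x^n` (multilinear over ℂ), satisfying, in terms of the associated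
`λ`-brackets evaluated at complex points: local finiteness (C1), conformal
sesquilinearity (C2), skew-symmetry including the last-slot relation
`[x¹⋯x^{n-1}_{λ_{n-1}}x^n] = −[x¹⋯x^n_{−∂−λ₁−⋯−λ_{n-1}}x^{n-1}]` (C3), and the conformal
Filippov identity (C4). -/
structure NLieConfAlg (m : ℕ) [NeZero m] (R : Type*) [AddCommGroup R] [Module ℂ R] where
  D : Module.End ℂ R
  prodl : (Fin m → ℕ) → MultilinearMap ℂ (fun _ : Fin (m + 1) => R) R
  locFin : ∀ x : Fin (m + 1) → R, ∃ N : ℕ, ∀ k : Fin m → ℕ, N ≤ ∑ s, k s → prodl k x = 0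
  sesq : ∀ (lam : Fin m → ℂ) (x : Fin (m + 1) → R) (i : Fin m),
    pEval prodl lam (Function.update x i.castSucc (D (x i.castSucc)))
      = -(lam i) • pEval prodl lam x
  sesqLast : ∀ (lam : Fin m → ℂ) (x : Fin (m + 1) → R),
    pEval prodl lam (Function.update x (Fin.last m) (D (x (Fin.last m))))
      = D (pEval prodl lam x) + (∑ s, lam s) • pEval prodl lam x
  skew : ∀ (lam : Fin m → ℂ) (x : Fin (m + 1) → R) (i j : Fin m), i ≠ j →
    pEval prodl (fun t => lam (Equiv.swap i j t))
        (fun t => x (Equiv.swap i.castSucc j.castSucc t))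
      = - pEval prodl lam x
  skewLast : ∀ (lam : Fin m → ℂ) (x : Fin (m + 1) → R),
    pEval prodl lam x
      = - pEvalOp D prodl lam (∑ s, lam s)
          (fun t => x (Equiv.swap (Fin.castSucc (lastIdx m)) (Fin.last m) t))
  filippov : ∀ (lam : Fin (m + 1) → ℂ) (mus : Fin m → ℂ)
      (a : Fin (m + 1) → R) (b : Fin m → R),
    ∑ i : Fin (m + 1), ((-1 : ℂ) ^ (m - (i : ℕ))) •
        pEval prodl (fun s => lam (i.succAbove s))
          (Fin.snoc (fun s => a (i.succAbove s))
            (pEval prodl (Function.update mus 0 (lam i)) (Fin.cons (a i) b)))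
      = pEval prodl (Function.update mus 0 (∑ i, lam i))
          (Fin.cons (pEval prodl (fun s => lam s.castSucc) a) b)

section Rep

variable {M : Type*} [AddCommGroup M] [Module ℂ M]

/-- Evaluation of the module action `a¹_{λ₁}⋯a^{n-1}_{λ_{n-1}} v` at complex values of
the `λ`'s, given its mode family `act`. -/
def aEval (act : (Fin m → ℕ) → MultilinearMap ℂ (fun _ : Fin m => R) (Module.End ℂ M))
    (lam : Fin m → ℂ) (a : Fin m → R) (v : M) : M :=
  ∑ᶠ k : Fin m → ℕ, (∏ s, dPow (lam s) (k s)) • (act k a) v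

/-- Evaluation of the module action where the last weight `λ_{n-1}` is replaced by the
operator `−∂ − c` (divided-power substitution). -/
def aEvalOp (DM : Module.End ℂ M)
    (act : (Fin m → ℕ) → MultilinearMap ℂ (fun _ : Fin m => R) (Module.End ℂ M))
    (lam : Fin m → ℂ) (c : ℂ) (a : Fin m → R) (v : M) : M :=
  ∑ᶠ k : Fin m → ℕ,
    (∏ s ∈ Finset.univ.erase (lastIdx m), dPow (lam s) (k s)) •
      (((k (lastIdx m)).factorial : ℂ)⁻¹ •
        ((-(DM + c • (1 : Module.End ℂ M))) ^ (k (lastIdx m))) ((act k a) v))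

/-- A conformal representation `M` of the `n`-Lie conformal algebra `R` (`n = m + 1`):
a `ℂ[∂]`-module `M` with multilinear actions `a¹_{(k₁)}⋯a^{n-1}_{(k_{n-1})} v`
satisfying (M1) local finiteness, (M2) conformal sesquilinearity in each slot,
(M3) skew-symmetry in the `R`-slots, and (M4) the two Filippov-type compatibility
identities (the second one written via formula (17) for `[(a's)_λ (b's)]_{λ+μ} v`). -/
structure ConfRep (m : ℕ) [NeZero m] {R : Type*} [AddCommGroup R] [Module ℂ R]
    (A : NLieConfAlg m R) (M : Type*) [AddCommGroup M] [Module ℂ M] where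
  DM : Module.End ℂ M
  act : (Fin m → ℕ) → MultilinearMap ℂ (fun _ : Fin m => R) (Module.End ℂ M)
  locFin : ∀ (a : Fin m → R) (v : M),
    ∃ N : ℕ, ∀ k : Fin m → ℕ, N ≤ ∑ s, k s → act k a v = 0
  sesq : ∀ (lam : Fin m → ℂ) (a : Fin m → R) (v : M) (i : Fin m),
    aEval act lam (Function.update a i (A.D (a i))) v = -(lam i) • aEval act lam a v
  sesqV : ∀ (lam : Fin m → ℂ) (a : Fin m → R) (v : M),
    aEval act lam a (DM v) = DM (aEval act lam a v) + (∑ s, lam s) • aEval act lam a v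
  skew : ∀ (lam : Fin m → ℂ) (a : Fin m → R) (v : M) (i j : Fin m), i ≠ j →
    aEval act (fun t => lam (Equiv.swap i j t)) (fun t => a (Equiv.swap i j t)) v
      = - aEval act lam a v
  filippov1 : ∀ (lam : Fin (m + 1) → ℂ) (mus : Fin m → ℂ)
      (a : Fin (m + 1) → R) (b : Fin m → R) (v : M),
    ∑ i : Fin (m + 1), ((-1 : ℂ) ^ (m - (i : ℕ))) •
        aEval act (fun s => lam (i.succAbove s)) (fun s => a (i.succAbove s))
          (aEval act (Function.update mus 0 (lam i)) (Function.update b 0 (a i)) v)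
      = aEval act (Function.update mus 0 (∑ i, lam i))
          (Function.update b 0 (pEval A.prodl (fun s => lam s.castSucc) a)) v
  filippov2 : ∀ (lam mu : Fin m → ℂ) (a b : Fin m → R) (v : M),
    aEval act lam a (aEval act mu b v) - aEval act mu b (aEval act lam a v)
      = ∑ i : Fin m,
          aEval act (Function.update mu i ((∑ s, lam s) + mu i))
            (Function.update b i (pEval A.prodl lam (Fin.snoc a (b i)))) v

/-- The conformal weights carried by the remaining slots after removing slot
`i.castSucc` from `a¹,…,a^n` (the removed `a^n` slot, now last, carries the operator
weight instead). -/
def lamRm (lam : Fin m → ℂ) (i : Fin m) : Fin m → ℂ :=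
  fun s => if h : ((i.castSucc.succAbove s : Fin (m + 1)) : ℕ) < m
    then lam ⟨((i.castSucc.succAbove s : Fin (m + 1)) : ℕ), h⟩ else 0

/-- Vector-valued functions on `X` that are polynomial in the coordinate functions in `S`. -/
inductive PolyFun {X : Type*} (S : Set (X → ℂ)) {M : Type*} [AddCommGroup M] [Module ℂ M] :
    (X → M) → Prop
  | const (w : M) : PolyFun S (fun _ => w)
  | add {f g : X → M} : PolyFun S f → PolyFun S g → PolyFun S (fun x => f x + g x)
  | mul {s : X → ℂ} {f : X → M} : s ∈ S → PolyFun S f → PolyFun S (fun x => s x • f x)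

namespace PolyFun

variable {X Y : Type*} {S : Set (X → ℂ)} {N : Type*} [AddCommGroup N] [Module ℂ N]

protected theorem map (T : M →ₗ[ℂ] N) {f : X → M} (hf : PolyFun S f) : PolyFun S (fun x => T (f x)) := by
  induction hf with
  | const w => exact .const _
  | add _ _ hf hg => simpa only [map_add] using hf.add hg
  | mul hs _ hf => simpa only [map_smul] using hf.mul hs

protected theorem smul {g : X → ℂ} {f : X → M} (hg : PolyFun S g) (hf : PolyFun S f) :
    PolyFun S (fun x => g x • f x) := by
  induction hg with
  | const w => exact hf.map (w • LinearMap.id)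
  | add _ _ h₁ h₂ => simpa only [add_smul] using h₁.add h₂
  | mul hs _ h => simpa only [smul_assoc] using h.mul hs

protected theorem coord {s : X → ℂ} (hs : s ∈ S) : PolyFun S s := by
  simpa using (PolyFun.const (S := S) (1 : ℂ)).mul hs

protected theorem sum {ι : Type*} (t : Finset ι) {f : ι → X → M} (hf : ∀ i ∈ t, PolyFun S (f i)) :
    PolyFun S (fun x => ∑ i ∈ t, f i x) := by
  classical
  induction t using Finset.induction_on with
  | empty => simpa using PolyFun.const (S := S) (0 : M)
  | insert a t ha ih =>
    simp only [Finset.sum_insert ha]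
    exact (hf a (Finset.mem_insert_self a t)).add
      (ih fun i hi => hf i (Finset.mem_insert_of_mem hi))

protected theorem prod {ι : Type*} (t : Finset ι) {f : ι → X → ℂ} (hf : ∀ i ∈ t, PolyFun S (f i)) :
    PolyFun S (fun x => ∏ i ∈ t, f i x) := by
  classical
  induction t using Finset.induction_on with
  | empty => simpa using PolyFun.const (S := S) (1 : ℂ)
  | insert a t ha ih =>
    simp only [Finset.prod_insert ha]
    exact (hf a (Finset.mem_insert_self a t)).smul
      (ih fun i hi => hf i (Finset.mem_insert_of_mem hi))

protected theorem neg {f : X → M} (hf : PolyFun S f) : PolyFun S (fun x => -f x) :=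
  hf.map (-LinearMap.id)

protected theorem sub {f g : X → M} (hf : PolyFun S f) (hg : PolyFun S g) :
    PolyFun S (fun x => f x - g x) := by
  simpa only [sub_eq_add_neg] using hf.add hg.neg

protected theorem dPow {g : X → ℂ} (hg : PolyFun S g) (k : ℕ) : PolyFun S (fun x => dPow (g x) k) := by
  have h := (PolyFun.prod (Finset.range k) (f := fun _ => g) fun _ _ => hg).map
    ((k.factorial : ℂ)⁻¹ • LinearMap.id)
  simpa [_root_.dPow, div_eq_inv_mul] using h

protected theorem comp {S' : Set (Y → ℂ)} {φ : Y → X} (hφ : ∀ s ∈ S, PolyFun S' (fun y => s (φ y)))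
    {f : X → M} (hf : PolyFun S f) : PolyFun S' (fun y => f (φ y)) := by
  induction hf with
  | const w => exact .const _
  | add _ _ hf hg => exact hf.add hg
  | mul hs _ hf => exact (hφ _ hs).smul hf

end PolyFun

/-- The function `z ↦ Σ_k z^k • p k` attached to a finitely supported family. -/
def powSum (M : Type*) [AddCommGroup M] [Module ℂ M] : (ℕ →₀ M) →ₗ[ℂ] (ℂ → M) :=
  Finsupp.lsum ℂ fun k => LinearMap.pi fun z => z ^ k • LinearMap.id

theorem powSum_apply (p : ℕ →₀ M) (z : ℂ) : powSum M p z = p.sum fun k w => z ^ k • w := by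
  simp [powSum, Finsupp.sum]

theorem powSum_single (k : ℕ) (w : M) : powSum M (Finsupp.single k w) = fun z => z ^ k • w := by
  ext z
  simp [powSum_apply]

theorem powSum_injective : Function.Injective (powSum M) := by
  refine (injective_iff_map_eq_zero _).2 fun p hp => Finsupp.ext fun k => ?_
  refine (Module.forall_dual_apply_eq_zero_iff ℂ _).1 fun φ => ?_
  have h : (∑ k ∈ p.support, Polynomial.monomial k (φ (p k)) : Polynomial ℂ) = 0 := by
    refine Polynomial.funext fun z => ?_
    have hz := congrArg φ (congrFun hp z)
    simpa [powSum_apply, Finsupp.sum, Polynomial.eval_finsetSum, mul_comm] using hz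
  have hk := congrArg (fun q => Polynomial.coeff q k) h
  by_cases hp : p k = 0
  · simp [hp]
  · simpa [Polynomial.finsetSum_coeff, Polynomial.coeff_monomial, hp] using hk

theorem PolyFun.exists_powSum {f : ℂ → M} (hf : PolyFun {id} f) : ∃ p, powSum M p = f := by
  induction hf with
  | const w => exact ⟨Finsupp.single 0 w, by simp [powSum_single]⟩
  | add _ _ hf hg =>
    obtain ⟨p, rfl⟩ := hf
    obtain ⟨q, rfl⟩ := hg
    exact ⟨p + q, by rw [map_add]; rfl⟩
  | mul hs hf' hf =>
    clear hf'
    obtain ⟨p, rfl⟩ := hf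
    obtain rfl := hs
    induction p using Finsupp.induction_linear with
    | zero => exact ⟨0, by ext; simp⟩
    | add p q hp hq =>
      obtain ⟨p', hp⟩ := hp
      obtain ⟨q', hq⟩ := hq
      refine ⟨p' + q', ?_⟩
      rw [map_add, hp, hq, map_add]
      ext z
      simp
    | single k w =>
      refine ⟨Finsupp.single (k + 1) w, ?_⟩
      ext z
      simp [powSum_single, pow_succ', mul_smul]

/-- A linear left inverse of `powSum`, extracting the coefficients of a polynomial function. -/
def powCoeff (M : Type*) [AddCommGroup M] [Module ℂ M] : (ℂ → M) →ₗ[ℂ] (ℕ →₀ M) :=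
  ((powSum M).exists_leftInverse_of_injective (LinearMap.ker_eq_bot.2 powSum_injective)).choose

theorem powCoeff_powSum (p : ℕ →₀ M) : powCoeff M (powSum M p) = p :=
  LinearMap.congr_fun ((powSum M).exists_leftInverse_of_injective
    (LinearMap.ker_eq_bot.2 powSum_injective)).choose_spec p

/-- Substitution of the operator `D` for the variable of a polynomial function, with `D`
acting on the coefficients. -/
def opSubst (D : Module.End ℂ M) : (ℂ → M) →ₗ[ℂ] M :=
  (Finsupp.lsum ℂ fun k => D ^ k) ∘ₗ powCoeff M

theorem opSubst_powSum (D : Module.End ℂ M) (p : ℕ →₀ M) :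
    opSubst D (powSum M p) = p.sum fun k w => (D ^ k) w := by
  simp [opSubst, powCoeff_powSum]

theorem opSubst_pow (D : Module.End ℂ M) (k : ℕ) (w : M) :
    opSubst D (fun z => z ^ k • w) = (D ^ k) w := by
  rw [← powSum_single, opSubst_powSum]
  simp

theorem opSubst_const (D : Module.End ℂ M) (w : M) : opSubst D (fun _ => w) = w := by
  simpa using opSubst_pow D 0 w

theorem opSubst_add (D : Module.End ℂ M) (f g : ℂ → M) :
    opSubst D (fun z => f z + g z) = opSubst D f + opSubst D g :=
  map_add _ f g

theorem opSubst_neg (D : Module.End ℂ M) (f : ℂ → M) :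
    opSubst D (fun z => -f z) = -opSubst D f :=
  map_neg _ f

theorem opSubst_smul (D : Module.End ℂ M) (c : ℂ) (f : ℂ → M) :
    opSubst D (fun z => c • f z) = c • opSubst D f :=
  map_smul _ c f

theorem opSubst_sum (D : Module.End ℂ M) {ι : Type*} (t : Finset ι) (f : ι → ℂ → M) :
    opSubst D (fun z => ∑ i ∈ t, f i z) = ∑ i ∈ t, opSubst D (f i) := by
  rw [← map_sum]
  congr 1
  ext z
  simp

theorem opSubst_mul (D : Module.End ℂ M) {f : ℂ → M} (hf : PolyFun {id} f) :
    opSubst D (fun z => z • f z) = D (opSubst D f) := by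
  obtain ⟨p, rfl⟩ := hf.exists_powSum
  clear hf
  induction p using Finsupp.induction_linear with
  | zero => simpa using opSubst_const D (0 : M)
  | add p q hp hq => 
    simp only [map_add, Pi.add_apply, smul_add, opSubst_add, hp, hq]
  | single k w =>
    simp only [powSum_single, opSubst_pow, ← mul_smul, ← pow_succ']
    rw [pow_succ', Module.End.mul_apply]

/-- Substituting `D` intertwines with maps commuting with `D` up to a shift of the variable. -/
theorem map_opSubst {N : Type*} [AddCommGroup N] [Module ℂ N] (D : Module.End ℂ M)
    (D' : Module.End ℂ N) (T : M →ₗ[ℂ] N) (c : ℂ) (hT : ∀ w, T (D w) = D' (T w) + c • T w)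
    {f : ℂ → M} (hf : PolyFun {id} f) :
    T (opSubst D f) = opSubst D' (fun z => T (f (z + c))) := by
  induction hf with
  | const w => simp [opSubst_const]
  | add _ _ hf hg => simp only [opSubst_add, map_add, hf, hg]
  | mul hs hf ih =>
    obtain rfl := hs
    have hf' : PolyFun {id} (fun z => T (_ : M)) := (hf.comp (S' := {id}) (φ := fun z => z + c)
      (by
        rintro _ rfl
        exact (PolyFun.coord (S := {id}) (s := id) rfl).add (.const c))).map T
    simp only [id]
    rw [opSubst_mul D hf, hT, ih, ← opSubst_mul D' hf', ← opSubst_smul, ← opSubst_add]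
    simp only [map_add, map_smul, add_smul]

/-- The coordinates of `Y × ℂ`, given coordinates of `Y`. -/
def prodCoords {Y : Type*} (S : Set (Y → ℂ)) : Set (Y × ℂ → ℂ) :=
  insert Prod.snd ((fun s p => s p.1) '' S)

theorem PolyFun.snd_coord {Y : Type*} {S : Set (Y → ℂ)} :
    PolyFun (prodCoords S) (fun p : Y × ℂ => p.2) :=
  .coord (Set.mem_insert _ _)

theorem PolyFun.fst_coord {Y : Type*} {S : Set (Y → ℂ)} {s : Y → ℂ} (hs : s ∈ S) :
    PolyFun (prodCoords S) (fun p : Y × ℂ => s p.1) :=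
  .coord (Set.mem_insert_of_mem _ ⟨s, hs, rfl⟩)

theorem PolyFun.slice {Y : Type*} {S : Set (Y → ℂ)} {f : Y × ℂ → M}
    (hf : PolyFun (prodCoords S) f) (y : Y) : PolyFun {id} (fun d => f (y, d)) := by
  refine hf.comp (φ := fun d => (y, d)) ?_
  rintro s (rfl | ⟨s, -, rfl⟩)
  · exact PolyFun.coord (S := {id}) (s := id) rfl
  · exact PolyFun.const (S := {id}) (s y)

protected theorem PolyFun.opSubst (D : Module.End ℂ M) {Y : Type*} {S : Set (Y → ℂ)} {f : Y × ℂ → M}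
    (hf : PolyFun (prodCoords S) f) : PolyFun S (fun y => opSubst D (fun d => f (y, d))) := by
  induction hf with
  | const w => simpa only [opSubst_const] using PolyFun.const (S := S) w
  | add _ _ hf hg => simpa only [opSubst_add] using hf.add hg
  | mul hs hf ih =>
    obtain rfl | ⟨s, hs, rfl⟩ := hs
    · simpa only [opSubst_mul D (hf.slice _)] using ih.map D
    · simpa only [opSubst_smul] using ih.mul hs

theorem opSubst_opSubst (D : Module.End ℂ M) {f : ℂ × ℂ → M}
    (hf : PolyFun (prodCoords {id}) f) :
    opSubst D (fun e => opSubst D (fun d => f (e, d))) = opSubst D (fun d => f (d, d)) := by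
  induction hf with
  | const w => simp only [opSubst_const]
  | add _ _ hf hg => simp only [opSubst_add, hf, hg]
  | @mul s f hs hf ih =>
    have hdiag : PolyFun {id} (fun d => f (d, d)) := by
      refine hf.comp (φ := fun d => (d, d)) ?_
      rintro _ (rfl | ⟨_, rfl, rfl⟩) <;> exact .coord rfl
    obtain rfl | ⟨_, rfl, rfl⟩ := hs
    · simp only [opSubst_mul D (hf.slice _)]
      have := map_opSubst D D D 0 (fun w => by simp) (hf.opSubst D)
      simp only [add_zero] at this
      rw [opSubst_mul D hdiag, ← ih, this]
    · simp only [id, opSubst_smul]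
      rw [opSubst_mul D (hf.opSubst D), ih, opSubst_mul D hdiag]

/-- The function `x ↦ Σ_k ∏ x_s^(k_s) • p k` attached to a finitely supported family. -/
def dPowSum (ι : Type*) [Fintype ι] (M : Type*) [AddCommGroup M] [Module ℂ M] :
    ((ι → ℕ) →₀ M) →ₗ[ℂ] ((ι → ℂ) → M) :=
  Finsupp.lsum ℂ fun k => LinearMap.pi fun x => (∏ s, dPow (x s) (k s)) • LinearMap.id

section DPowSum

variable {ι : Type*} [Fintype ι]

theorem dPowSum_apply (p : (ι → ℕ) →₀ M) (x : ι → ℂ) :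
    dPowSum ι M p x = p.sum fun k w => (∏ s, dPow (x s) (k s)) • w := by
  simp [dPowSum, Finsupp.sum]

theorem dPowSum_single (k : ι → ℕ) (w : M) :
    dPowSum ι M (Finsupp.single k w) = fun x => (∏ s, dPow (x s) (k s)) • w := by
  ext x
  simp [dPowSum_apply]

theorem dPowSum_injective : Function.Injective (dPowSum ι M) := by
  classical
  refine (injective_iff_map_eq_zero _).2 fun p hp => Finsupp.ext fun k => ?_
  refine (Module.forall_dual_apply_eq_zero_iff ℂ _).1 fun φ => ?_
  have h : (∑ k ∈ p.support, MvPolynomial.monomial (Finsupp.equivFunOnFinite.symm k)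
      ((∏ s, ((k s).factorial : ℂ)⁻¹) * φ (p k)) : MvPolynomial ι ℂ) = 0 := by
    refine MvPolynomial.funext fun z => ?_
    have hz := congrArg φ (congrFun hp z)
    simp only [dPowSum_apply, Finsupp.sum, map_sum, map_smul, smul_eq_mul, Pi.zero_apply,
      map_zero] at hz
    rw [map_sum, map_zero, ← hz]
    refine Finset.sum_congr rfl fun k _ => ?_
    rw [MvPolynomial.eval_monomial, Finsupp.prod_fintype _ _ (by simp)]
    simp only [dPow, div_eq_mul_inv, Finset.prod_mul_distrib, Finsupp.equivFunOnFinite_symm_apply_apply]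
    ring
  have hk := congrArg (MvPolynomial.coeff (Finsupp.equivFunOnFinite.symm k)) h
  by_cases hp : p k = 0
  · simp [hp]
  · simpa [MvPolynomial.coeff_sum, MvPolynomial.coeff_monomial, hp, Finset.prod_eq_zero_iff,
      Nat.factorial_ne_zero] using hk

/-- The coordinate functions on `ι → ℂ`. -/
def piCoords (ι : Type*) : Set ((ι → ℂ) → ℂ) := Set.range fun i x => x i

theorem PolyFun.exists_dPowSum {f : (ι → ℂ) → M} (hf : PolyFun (piCoords ι) f) :
    ∃ p, dPowSum ι M p = f := by
  classical
  induction hf with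
  | const w => exact ⟨Finsupp.single 0 w, by simp [dPowSum_single, dPow]⟩
  | add _ _ hf hg =>
    obtain ⟨p, rfl⟩ := hf
    obtain ⟨q, rfl⟩ := hg
    exact ⟨p + q, by rw [map_add]; rfl⟩
  | mul hs hf' hf =>
    clear hf'
    obtain ⟨p, rfl⟩ := hf
    obtain ⟨i, rfl⟩ := hs
    induction p using Finsupp.induction_linear with
    | zero => exact ⟨0, by ext; simp⟩
    | add p q hp hq =>
      obtain ⟨p', hp⟩ := hp
      obtain ⟨q', hq⟩ := hq
      refine ⟨p' + q', ?_⟩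
      rw [map_add, hp, hq, map_add]
      ext z
      simp
    | single k w =>
      refine ⟨Finsupp.single (Function.update k i (k i + 1)) ((k i + 1 : ℂ) • w), ?_⟩
      ext x
      simp only [dPowSum_single, ← mul_smul]
      congr 1
      rw [← Finset.mul_prod_erase _ _ (Finset.mem_univ i),
        ← Finset.mul_prod_erase _ _ (Finset.mem_univ i),
        Finset.prod_congr rfl (g := fun s => dPow (x s) (k s)) fun s hs => by
          rw [Function.update_of_ne (Finset.ne_of_mem_erase hs)]]
      simp only [dPow, Function.update_self, pow_succ, Nat.factorial_succ, Nat.cast_mul]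
      push_cast
      have h1 : (k i + 1 : ℂ) ≠ 0 := by exact_mod_cast Nat.succ_ne_zero (k i)
      have h2 : ((k i).factorial : ℂ) ≠ 0 := by exact_mod_cast Nat.factorial_ne_zero (k i)
      field_simp

/-- A linear left inverse of `dPowSum`, extracting the divided-power coefficients. -/
def dPowCoeff (ι : Type*) [Fintype ι] (M : Type*) [AddCommGroup M] [Module ℂ M] :
    ((ι → ℂ) → M) →ₗ[ℂ] ((ι → ℕ) →₀ M) :=
  ((dPowSum ι M).exists_leftInverse_of_injective
    (LinearMap.ker_eq_bot.2 dPowSum_injective)).choose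

theorem dPowCoeff_dPowSum (p : (ι → ℕ) →₀ M) : dPowCoeff ι M (dPowSum ι M p) = p :=
  LinearMap.congr_fun ((dPowSum ι M).exists_leftInverse_of_injective
    (LinearMap.ker_eq_bot.2 dPowSum_injective)).choose_spec p

theorem dPowSum_dPowCoeff {f : (ι → ℂ) → M} (hf : PolyFun (piCoords ι) f) :
    dPowSum ι M (dPowCoeff ι M f) = f := by
  obtain ⟨p, rfl⟩ := hf.exists_dPowSum
  rw [dPowCoeff_dPowSum]

end DPowSum

section Sign

variable {n : ℕ} {X Z : Type*} [AddCommGroup Z] [Module ℂ Z]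

theorem comp_perm_of_adjacent (Φ : (Fin (n + 1) → X) → Z)
    (h : ∀ (i : Fin n) y, Φ (y ∘ Equiv.swap i.castSucc i.succ) = -Φ y)
    (σ : Equiv.Perm (Fin (n + 1))) (y : Fin (n + 1) → X) :
    Φ (y ∘ σ) = ((Equiv.Perm.sign σ : ℤ) : ℂ) • Φ y := by
  have hσ : σ ∈ Submonoid.closure
      (Set.range fun i : Fin n => Equiv.swap i.castSucc i.succ) := by
    rw [Equiv.Perm.mclosure_swap_castSucc_succ]
    trivial
  induction hσ using Submonoid.closure_induction generalizing y with
  | mem σ hσ =>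
    obtain ⟨i, rfl⟩ := hσ
    simp [h, Equiv.Perm.sign_swap (Fin.castSucc_lt_succ (i := i)).ne]
  | one => simp
  | mul σ τ _ _ hσ hτ =>
    rw [Equiv.Perm.coe_mul, ← Function.comp_assoc, hτ, hσ]
    simp [← mul_smul, mul_comm]

/-- The alternating sum over the ways of singling out one argument of an antisymmetric function
is antisymmetric. -/
theorem altSum_comp_perm (V : (Fin n → X) → X → Z)
    (hV : ∀ (σ : Equiv.Perm (Fin n)) y u, V (y ∘ σ) u = ((Equiv.Perm.sign σ : ℤ) : ℂ) • V y u)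
    (z : Fin (n + 1) → X) (σ : Equiv.Perm (Fin (n + 1))) :
    ∑ i : Fin (n + 1), (-1 : ℂ) ^ (i : ℕ) • V (fun s => z (σ (i.succAbove s))) (z (σ i))
      = ((Equiv.Perm.sign σ : ℤ) : ℂ) •
        ∑ i : Fin (n + 1), (-1 : ℂ) ^ (i : ℕ) • V (fun s => z (i.succAbove s)) (z i) := by
  rw [← Equiv.sum_comp σ (fun i : Fin (n + 1) =>
    (-1 : ℂ) ^ (i : ℕ) • V (fun s => z (i.succAbove s)) (z i)), Finset.smul_sum]
  refine Finset.sum_congr rfl fun i _ => ?_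
  obtain ⟨⟨p, e⟩, he⟩ := Equiv.Perm.decomposeFin.symm.surjective
    ((σ i).cycleRange * σ * i.cycleRange⁻¹)
  have hp : p = 0 := by
    have := congrArg (fun τ : Equiv.Perm (Fin (n + 1)) => τ 0) he
    simpa [Equiv.Perm.inv_def] using this
  subst hp
  have hs : ∀ s, σ (i.succAbove s) = (σ i).succAbove (e s) := by
    intro s
    have := congrArg (fun τ : Equiv.Perm (Fin (n + 1)) => τ s.succ) he
    simp only [Equiv.Perm.decomposeFin_symm_apply_succ, Equiv.swap_self, Equiv.refl_apply,
      Equiv.Perm.mul_apply, Equiv.Perm.inv_def, Fin.cycleRange_symm_succ] at this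
    rw [← Fin.cycleRange_symm_succ (σ i), this, Equiv.symm_apply_apply]
  have hsign : ((Equiv.Perm.sign e : ℤ) : ℂ)
      = (-1) ^ (σ i : ℕ) * ((Equiv.Perm.sign σ : ℤ) : ℂ) * (-1) ^ (i : ℕ) := by
    have := congrArg (fun τ => ((Equiv.Perm.sign τ : ℤ) : ℂ)) he
    simpa [Equiv.Perm.decomposeFin.symm_sign, Fin.sign_cycleRange] using this
  have hV' := hV e (fun s => z ((σ i).succAbove s)) (z (σ i))
  simp only [hs]
  rw [show (fun s => z ((σ i).succAbove (e s))) = (fun s => z ((σ i).succAbove s)) ∘ e from rfl,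
    hV', hsign, ← mul_smul, ← mul_smul]
  congr 1
  have : ((-1 : ℂ) ^ (i : ℕ)) * (-1) ^ (i : ℕ) = 1 := by simp [← mul_pow]
  linear_combination ((-1 : ℂ) ^ (σ i : ℕ)) * ((Equiv.Perm.sign σ : ℤ) : ℂ) * this

theorem snoc_eq_cons_comp_finRotate (y : Fin n → X) (u : X) :
    (Fin.snoc y u : Fin (n + 1) → X) = (Fin.cons u y : Fin (n + 1) → X) ∘ finRotate (n + 1) := by
  ext i
  exact congrFun (Fin.snoc_eq_cons_rotate (α := X) y u) i

theorem apply_snoc_eq_apply_cons (Φ : (Fin (n + 1) → X) → Z)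
    (hΦ : ∀ (σ : Equiv.Perm (Fin (n + 1))) y, Φ (y ∘ σ) = ((Equiv.Perm.sign σ : ℤ) : ℂ) • Φ y)
    (y : Fin n → X) (u : X) :
    Φ (Fin.snoc y u) = (-1 : ℂ) ^ n • Φ (Fin.cons u y) := by
  rw [snoc_eq_cons_comp_finRotate, hΦ, sign_finRotate]
  simp

theorem apply_snoc_succAbove (Φ : (Fin (n + 1) → X) → Z)
    (hΦ : ∀ (σ : Equiv.Perm (Fin (n + 1))) y, Φ (y ∘ σ) = ((Equiv.Perm.sign σ : ℤ) : ℂ) • Φ y)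
    (y : Fin (n + 1) → X) (i : Fin (n + 1)) (u : X) :
    Φ (Fin.snoc (fun s => y (i.succAbove s)) u)
      = ((-1 : ℂ) ^ n * (-1) ^ (i : ℕ)) • Φ (Function.update y i u) := by
  rw [apply_snoc_eq_apply_cons Φ hΦ]
  have : (Fin.cons u (fun s => y (i.succAbove s)) : Fin (n + 1) → X)
      = Function.update y i u ∘ (i.cycleRange⁻¹ : Equiv.Perm (Fin (n + 1))) := by
    ext s
    refine Fin.cases ?_ (fun s => ?_) s
    · simp [Equiv.Perm.inv_def]
    · simp [Equiv.Perm.inv_def, Fin.succAbove_ne]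
  rw [this, hΦ, mul_smul]
  simp [Fin.sign_cycleRange]

end Sign

section OpSubst

variable {D : Module.End ℂ M}

theorem prod_dPow_update {ι : Type*} [Fintype ι] [DecidableEq ι] (lam : ι → ℂ) (i : ι) (w : ℂ)
    (k : ι → ℕ) :
    ∏ s, dPow (Function.update lam i w s) (k s)
      = dPow w (k i) * ∏ s ∈ Finset.univ.erase i, dPow (lam s) (k s) := by
  rw [← Finset.mul_prod_erase _ _ (Finset.mem_univ i), Function.update_self]
  congr 1
  exact Finset.prod_congr rfl fun s hs => by
    rw [Function.update_of_ne (Finset.ne_of_mem_erase hs)]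

theorem finsum_eq_sum_of_forall_notMem {ι P Q : Type*} [AddCommMonoid Q] [Zero P] {p : ι → P}
    {S : Finset ι} (hS : ∀ k, k ∉ S → p k = 0) {f : ι → Q} (hf : ∀ k, p k = 0 → f k = 0) :
    ∑ᶠ k, f k = ∑ k ∈ S, f k := by
  refine finsum_eq_sum_of_support_subset _ fun k hk => ?_
  by_contra h
  exact hk (hf k (hS k h))

theorem opSubst_neg_sub_pow (c : ℂ) (w : M) (j : ℕ) :
    opSubst D (fun d => (-d - c) ^ j • w) = ((-(D + c • (1 : Module.End ℂ M))) ^ j) w := by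
  induction j with
  | zero => simpa using opSubst_const D w
  | succ j ih =>
    have hlin : PolyFun {id} (fun d : ℂ => -d - c) :=
      (PolyFun.coord (S := {id}) (s := id) rfl).neg.sub (.const c)
    have hp : PolyFun {id} (fun d : ℂ => (-d - c) ^ j • w) := by
      have := (PolyFun.prod (Finset.range j) fun _ _ => hlin).smul (.const w)
      simpa using this
    have : (fun d : ℂ => (-d - c) ^ (j + 1) • w)
        = fun d => -(d • ((-d - c) ^ j • w)) + -(c • ((-d - c) ^ j • w)) := by
      ext d
      rw [← mul_smul, ← mul_smul, ← neg_smul, ← neg_smul, ← add_smul]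
      ring_nf
    rw [this, opSubst_add, opSubst_neg, opSubst_neg, opSubst_smul, opSubst_mul D hp, ih, pow_succ',
      Module.End.mul_apply]
    simp [add_comm]

/-- Substituting `−∂ − c` for the last weight of a polynomial given by its divided-power
coefficients. -/
theorem finsum_op_eq_opSubst (lam : Fin m → ℂ) (c : ℂ) {p : (Fin m → ℕ) → M}
    {S : Finset (Fin m → ℕ)} (hS : ∀ k, k ∉ S → p k = 0) :
    ∑ᶠ k : Fin m → ℕ, (∏ s ∈ Finset.univ.erase (lastIdx m), dPow (lam s) (k s)) •
      (((k (lastIdx m)).factorial : ℂ)⁻¹ •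
        ((-(D + c • (1 : Module.End ℂ M))) ^ (k (lastIdx m))) (p k))
      = opSubst D (fun d => ∑ᶠ k : Fin m → ℕ,
          (∏ s, dPow (Function.update lam (lastIdx m) (-d - c) s) (k s)) • p k) := by
  rw [finsum_eq_sum_of_forall_notMem hS fun k hk => by simp [hk]]
  have : ∀ d : ℂ, ∑ᶠ k : Fin m → ℕ,
      (∏ s, dPow (Function.update lam (lastIdx m) (-d - c) s) (k s)) • p k
      = ∑ k ∈ S, (∏ s, dPow (Function.update lam (lastIdx m) (-d - c) s) (k s)) • p k :=
    fun d => finsum_eq_sum_of_forall_notMem hS fun k hk => by simp [hk]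
  simp only [this]
  rw [opSubst_sum]
  refine Finset.sum_congr rfl fun k _ => ?_
  rw [← opSubst_neg_sub_pow, ← opSubst_smul, ← opSubst_smul]
  congr 1
  ext d
  rw [prod_dPow_update, dPow]
  simp only [← mul_smul]
  congr 1
  ring

theorem exists_finset_of_locFin {n : ℕ} {P : Type*} [Zero P] {p : (Fin n → ℕ) → P}
    (h : ∃ N : ℕ, ∀ k : Fin n → ℕ, N ≤ ∑ s, k s → p k = 0) :
    ∃ S : Finset (Fin n → ℕ), ∀ k, k ∉ S → p k = 0 := by
  obtain ⟨N, hN⟩ := h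
  refine ⟨Fintype.piFinset fun _ => Finset.range N, fun k hk => hN k ?_⟩
  simp only [Fintype.mem_piFinset, Finset.mem_range, not_forall, not_lt] at hk
  obtain ⟨s, hs⟩ := hk
  exact hs.trans (Finset.single_le_sum (f := k) (fun _ _ => Nat.zero_le _) (Finset.mem_univ s))

end OpSubst

namespace NLieConfAlg

variable (A : NLieConfAlg m R)

theorem map_pEvalOp (T : R →ₗ[ℂ] M) (w : ℂ) (hT : ∀ r, T (A.D r) = -w • T r)
    (lam : Fin m → ℂ) (c : ℂ) (x : Fin (m + 1) → R) :
    T (pEvalOp A.D A.prodl lam c x)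
      = T (pEval A.prodl (Function.update lam (lastIdx m) (w - c)) x) := by
  obtain ⟨S, hS⟩ := exists_finset_of_locFin (A.locFin x)
  have hpow : ∀ j r, T (((-(A.D + c • (1 : Module.End ℂ R))) ^ j) r) = (w - c) ^ j • T r := by
    intro j
    induction j with
    | zero => simp
    | succ j ih =>
      intro r
      rw [pow_succ, Module.End.mul_apply, ih, pow_succ, mul_smul]
      simp [hT, sub_smul, ← sub_eq_add_neg, add_comm]
  rw [pEvalOp, pEval, finsum_eq_sum_of_forall_notMem hS fun k hk => by simp [hk],
    finsum_eq_sum_of_forall_notMem hS fun k hk => by simp [hk],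
    map_sum, map_sum]
  refine Finset.sum_congr rfl fun k _ => ?_
  rw [map_smul, map_smul, hpow, map_smul, prod_dPow_update]
  simp only [dPow, ← mul_smul]
  congr 1
  ring

end NLieConfAlg

namespace ConfRep

section Basic

variable {A : NLieConfAlg m R} (ρ : ConfRep m A M)

theorem aEval_eq_sum {a : Fin m → R} {v : M} {S : Finset (Fin m → ℕ)}
    (hS : ∀ k, k ∉ S → ρ.act k a v = 0) (lam : Fin m → ℂ) :
    aEval ρ.act lam a v = ∑ k ∈ S, (∏ s, dPow (lam s) (k s)) • (ρ.act k a) v :=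
  finsum_eq_sum_of_forall_notMem hS fun k hk => by simp [hk]

theorem hasFiniteSupport_aEval (lam : Fin m → ℂ) (a : Fin m → R) (v : M) :
    (Function.support fun k : Fin m → ℕ =>
      (∏ s, dPow (lam s) (k s)) • (ρ.act k a) v).Finite := by
  obtain ⟨S, hS⟩ := exists_finset_of_locFin (ρ.locFin a v)
  refine S.finite_toSet.subset fun k hk => ?_
  by_contra h
  exact hk (by simp [hS k h])

/-- The action at fixed complex weights as a multilinear map into endomorphisms. -/
def evalMap (lam : Fin m → ℂ) : MultilinearMap ℂ (fun _ : Fin m => R) (Module.End ℂ M) where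
  toFun a :=
    { toFun := aEval ρ.act lam a
      map_add' := fun v w => by
        simp only [aEval, map_add, smul_add]
        exact finsum_add_distrib (ρ.hasFiniteSupport_aEval lam a v)
          (ρ.hasFiniteSupport_aEval lam a w)
      map_smul' := fun c v => by
        simp only [aEval, map_smul, RingHom.id_apply, smul_comm _ c]
        exact (smul_finsum' c (ρ.hasFiniteSupport_aEval lam a v)).symm }
  map_update_add' := fun a i r r' => by
    ext v
    simp only [LinearMap.coe_mk, AddHom.coe_mk, LinearMap.add_apply, aEval,
      MultilinearMap.map_update_add, smul_add]
    exact finsum_add_distrib (ρ.hasFiniteSupport_aEval lam _ v)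
      (ρ.hasFiniteSupport_aEval lam _ v)
  map_update_smul' := fun a i c r => by
    ext v
    simp only [LinearMap.coe_mk, AddHom.coe_mk, LinearMap.smul_apply, aEval,
      MultilinearMap.map_update_smul, smul_comm _ c]
    exact (smul_finsum' c (ρ.hasFiniteSupport_aEval lam _ v)).symm

theorem aEval_eq_evalMap (lam : Fin m → ℂ) (a : Fin m → R) (v : M) :
    aEval ρ.act lam a v = ρ.evalMap lam a v := rfl

theorem polyFun_aEval {X : Type*} {S : Set (X → ℂ)} {L : X → Fin m → ℂ}
    (hL : ∀ i, PolyFun S (fun x => L x i)) (a : Fin m → R) {f : X → M} (hf : PolyFun S f) :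
    PolyFun S (fun x => aEval ρ.act (L x) a (f x)) := by
  induction hf with
  | const w =>
    obtain ⟨T, hT⟩ := exists_finset_of_locFin (ρ.locFin a w)
    simp only [ρ.aEval_eq_sum hT]
    exact .sum _ fun k _ => (PolyFun.prod _ fun s _ => (hL s).dPow (k s)).smul (.const _)
  | add _ _ hf hg =>
    simp only [aEval_eq_evalMap, map_add] at *
    exact hf.add hg
  | mul hs _ hf =>
    simp only [aEval_eq_evalMap, map_smul] at *
    exact hf.mul hs

theorem aEvalOp_eq_opSubst (lam : Fin m → ℂ) (c : ℂ) (a : Fin m → R) (v : M) :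
    aEvalOp ρ.DM ρ.act lam c a v
      = opSubst ρ.DM (fun d => aEval ρ.act (Function.update lam (lastIdx m) (-d - c)) a v) :=
  let ⟨_, hS⟩ := exists_finset_of_locFin (ρ.locFin a v)
  finsum_op_eq_opSubst lam c hS

theorem aEval_opSubst (lam : Fin m → ℂ) (a : Fin m → R) {f : ℂ → M} (hf : PolyFun {id} f) :
    aEval ρ.act lam a (opSubst ρ.DM f)
      = opSubst ρ.DM (fun z => aEval ρ.act lam a (f (z + ∑ s, lam s))) :=
  map_opSubst ρ.DM ρ.DM (ρ.evalMap lam a) _ (ρ.sesqV lam a) hf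

theorem aEval_comp_perm (v : M) (σ : Equiv.Perm (Fin m)) (y : Fin m → ℂ × R) :
    aEval ρ.act (fun t => (y (σ t)).1) (fun t => (y (σ t)).2) v
      = ((Equiv.Perm.sign σ : ℤ) : ℂ) • aEval ρ.act (fun t => (y t).1) (fun t => (y t).2) v := by
  obtain ⟨n, rfl⟩ : ∃ n, m = n + 1 := Nat.exists_eq_succ_of_ne_zero (NeZero.ne m)
  refine comp_perm_of_adjacent
    (fun y : Fin (n + 1) → ℂ × R => aEval ρ.act (fun t => (y t).1) (fun t => (y t).2) v) ?_ σ y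
  intro i y
  have h := ρ.skew (fun t => (y t).1) (fun t => (y t).2) v i.castSucc i.succ
    (Fin.castSucc_lt_succ (i := i)).ne
  simpa only [Function.comp_apply] using h

/-- Feeding a bracket into a slot of the action, at the total weight of the bracket, is
antisymmetric in all the arguments of the bracket. -/
theorem aEval_bracket_comp_perm (θ : Fin m → ℂ) (c : Fin m → R) (p : Fin m) (v : M)
    (σ : Equiv.Perm (Fin (m + 1))) (y : Fin (m + 1) → ℂ × R) :
    aEval ρ.act (Function.update θ p (∑ i, (y i).1))
        (Function.update c p (pEval A.prodl (fun s => (y (σ s.castSucc)).1)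
          (fun i => (y (σ i)).2))) v
      = ((Equiv.Perm.sign σ : ℤ) : ℂ) • aEval ρ.act (Function.update θ p (∑ i, (y i).1))
        (Function.update c p (pEval A.prodl (fun s => (y s.castSucc).1)
          (fun i => (y i).2))) v := by
  have key := comp_perm_of_adjacent (fun y : Fin (m + 1) → ℂ × R =>
    aEval ρ.act (Function.update θ p (∑ i, (y i).1))
        (Function.update c p (pEval A.prodl (fun s => (y s.castSucc).1)
          (fun i => (y i).2))) v) ?_ σ y
  · simpa only [Function.comp_apply, Equiv.sum_comp σ (fun i => (y i).1)] using key
  intro i y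
  simp only [Function.comp_apply, Equiv.sum_comp _ (fun i => (y i).1)]
  set w := ∑ i, (y i).1 with hw
  let T : R →ₗ[ℂ] M :=
    LinearMap.applyₗ v ∘ₗ (ρ.evalMap (Function.update θ p w)).toLinearMap c p
  have hT : ∀ r, aEval ρ.act (Function.update θ p w) (Function.update c p r) v = T r :=
    fun _ => rfl
  have hTD : ∀ r, T (A.D r) = -w • T r := by
    intro r
    simpa [hT] using ρ.sesq (Function.update θ p w) (Function.update c p r) v p
  rw [hT, hT]
  by_cases hi : i.succ = Fin.last m
  · have hi' : i = lastIdx m := by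
      ext
      have := congrArg Fin.val hi
      simp [lastIdx] at this ⊢
      omega
    rw [A.skewLast (fun s => (y s.castSucc).1), map_neg, neg_neg, A.map_pEvalOp T w hTD, hi, ← hi']
    congr 2
    ext s
    by_cases hs : s = i
    · subst hs
      rw [Function.update_self, Equiv.swap_apply_left, hw, Fin.sum_univ_castSucc]
      ring
    · rw [Function.update_of_ne hs, Equiv.swap_apply_of_ne_of_ne
        (fun h => hs (Fin.castSucc_injective _ h)) (Fin.castSucc_lt_last s).ne]
  · obtain ⟨j, hj⟩ := Fin.exists_castSucc_eq.2 hi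
    have hij : i ≠ j := by
      rintro rfl
      exact (Fin.castSucc_lt_succ (i := i)).ne hj
    rw [← map_neg, ← A.skew _ _ i j hij, ← hj]
    congr 2
    ext s
    rw [(Fin.castSucc_injective m).map_swap]

/-- The action part of the semidirect bracket, with independent complex weights in all slots. -/
def semi (L : Fin (m + 1) → ℂ) (x : Fin (m + 1) → R × M) : M :=
  ∑ i : Fin (m + 1), (-1 : ℂ) ^ (m - (i : ℕ)) •
    aEval ρ.act (fun s => L (i.succAbove s)) (fun s => (x (i.succAbove s)).1) (x i).2

theorem semi_update (L : Fin (m + 1) → ℂ) (x : Fin (m + 1) → R × M) (j : Fin (m + 1))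
    (u : R × M) :
    ρ.semi L (Function.update x j u)
      = (-1 : ℂ) ^ (m - (j : ℕ)) •
          aEval ρ.act (fun s => L (j.succAbove s)) (fun s => (x (j.succAbove s)).1) u.2
        + ∑ i : Fin m, (-1 : ℂ) ^ (m - (j.succAbove i : ℕ)) •
          aEval ρ.act (fun s => L ((j.succAbove i).succAbove s))
            (Function.update (fun s => (x ((j.succAbove i).succAbove s)).1) (i.predAbove j) u.1)
            (x (j.succAbove i)).2 := by
  rw [semi, Fin.sum_univ_succAbove _ j]
  congr 1
  · simp [Fin.succAbove_ne]
  · refine Finset.sum_congr rfl fun i _ => ?_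
    rw [Function.update_of_ne (Fin.succAbove_ne j i)]
    congr 2
    ext s
    by_cases hs : s = i.predAbove j
    · subst hs
      simp [Fin.succAbove_succAbove_predAbove]
    · rw [Function.update_of_ne hs, Function.update_of_ne]
      intro h
      exact hs (Fin.succAbove_right_injective
        (h.trans (Fin.succAbove_succAbove_predAbove j i).symm))

theorem semi_update_add (L : Fin (m + 1) → ℂ) (x : Fin (m + 1) → R × M) (j : Fin (m + 1))
    (u v : R × M) :
    ρ.semi L (Function.update x j (u + v))
      = ρ.semi L (Function.update x j u) + ρ.semi L (Function.update x j v) := by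
  simp only [semi_update, aEval_eq_evalMap, Prod.fst_add, Prod.snd_add, map_add,
    MultilinearMap.map_update_add, LinearMap.add_apply, smul_add, Finset.sum_add_distrib]
  abel

theorem semi_update_smul (L : Fin (m + 1) → ℂ) (x : Fin (m + 1) → R × M) (j : Fin (m + 1))
    (c : ℂ) (u : R × M) :
    ρ.semi L (Function.update x j (c • u)) = c • ρ.semi L (Function.update x j u) := by
  simp only [semi_update, aEval_eq_evalMap, Prod.smul_fst, Prod.smul_snd, map_smul,
    MultilinearMap.map_update_smul, LinearMap.smul_apply, smul_add, Finset.smul_sum]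
  simp only [smul_comm c]

theorem semi_update_D (L : Fin (m + 1) → ℂ) (x : Fin (m + 1) → R × M) (j : Fin (m + 1)) :
    ρ.semi L (Function.update x j (A.D (x j).1, ρ.DM (x j).2))
      = ρ.DM ((-1 : ℂ) ^ (m - (j : ℕ)) •
          aEval ρ.act (fun s => L (j.succAbove s)) (fun s => (x (j.succAbove s)).1) (x j).2)
        + (∑ i, L i) • ((-1 : ℂ) ^ (m - (j : ℕ)) •
          aEval ρ.act (fun s => L (j.succAbove s)) (fun s => (x (j.succAbove s)).1) (x j).2)
        - L j • ρ.semi L x := by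
  conv_rhs => rw [← Function.update_eq_self j x]
  rw [semi_update, semi_update]
  simp only [ρ.sesqV, Function.update_self, Function.update_eq_self]
  have h : ∀ i : Fin m, aEval ρ.act (fun s => L ((j.succAbove i).succAbove s))
      (Function.update (fun s => (x ((j.succAbove i).succAbove s)).1) (i.predAbove j)
        (A.D (x j).1)) (x (j.succAbove i)).2
      = - L j • aEval ρ.act (fun s => L ((j.succAbove i).succAbove s))
      (Function.update (fun s => (x ((j.succAbove i).succAbove s)).1) (i.predAbove j)
        (x j).1) (x (j.succAbove i)).2 := by
    intro i
    have := ρ.sesq (fun s => L ((j.succAbove i).succAbove s))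
      (Function.update (fun s => (x ((j.succAbove i).succAbove s)).1) (i.predAbove j)
        (x j).1) (x (j.succAbove i)).2 (i.predAbove j)
    simpa [Fin.succAbove_succAbove_predAbove] using this
  simp only [h, Fin.sum_univ_succAbove L j, smul_comm _ (-L j), ← Finset.smul_sum, map_smul]
  module

theorem polyFun_semi {X : Type*} {S : Set (X → ℂ)} {L : X → Fin (m + 1) → ℂ}
    (hL : ∀ i, PolyFun S (fun x => L x i)) (x : Fin (m + 1) → R × M) :
    PolyFun S (fun y => ρ.semi (L y) x) :=
  .sum _ fun _ _ => PolyFun.smul (.const _) (ρ.polyFun_aEval (fun _ => hL _) _ (.const _))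

theorem neg_one_pow_sub {n : ℕ} (i : Fin (n + 1)) :
    (-1 : ℂ) ^ (n - (i : ℕ)) = (-1) ^ n * (-1) ^ (i : ℕ) := by
  rw [← pow_add, neg_one_pow_congr]
  have := i.is_le
  rw [Nat.even_sub this, Nat.even_add]

theorem semi_comp_perm (L : Fin (m + 1) → ℂ) (x : Fin (m + 1) → R × M)
    (σ : Equiv.Perm (Fin (m + 1))) :
    ρ.semi (fun t => L (σ t)) (fun t => x (σ t))
      = ((Equiv.Perm.sign σ : ℤ) : ℂ) • ρ.semi L x := by
  have := altSum_comp_perm (fun (y : Fin m → ℂ × (R × M)) (u : ℂ × (R × M)) =>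
    aEval ρ.act (fun t => (y t).1) (fun t => (y t).2.1) u.2.2)
    (fun τ y u => ρ.aEval_comp_perm u.2.2 τ fun t => ((y t).1, (y t).2.1))
    (fun t => (L t, x t)) σ
  simp only [semi, neg_one_pow_sub, mul_smul, ← Finset.smul_sum]
  rw [this, smul_comm]

/-- The `M`-component of the semidirect bracket. -/
def semiBracket (lam : Fin m → ℂ) (x : Fin (m + 1) → R × M) : M :=
  opSubst ρ.DM (fun d => ρ.semi (Fin.snoc lam (-d - ∑ s, lam s)) x)

theorem polyFun_snoc {n : ℕ} {X : Type*} {S : Set (X → ℂ)} {L : X → Fin n → ℂ} {g : X → ℂ}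
    (hL : ∀ i, PolyFun S (fun x => L x i)) (hg : PolyFun S g) (i : Fin (n + 1)) :
    PolyFun S (fun x => (Fin.snoc (L x) (g x) : Fin (n + 1) → ℂ) i) := by
  refine Fin.lastCases ?_ (fun i => ?_) i
  · simpa using hg
  · simpa using hL i

theorem opSubst_semi_update_opSubst {L : ℂ → Fin (m + 1) → ℂ}
    (hL : ∀ i, PolyFun {id} (fun d => L d i)) (hsum : ∀ d, ∑ i, L d i = -d)
    (x : Fin (m + 1) → R × M) (j : Fin (m + 1)) (r : R) {f : ℂ → M} (hf : PolyFun {id} f) :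
    opSubst ρ.DM (fun d => ρ.semi (L d) (Function.update x j (r, opSubst ρ.DM f)))
      = opSubst ρ.DM (fun d => ρ.semi (L d) (Function.update x j (r, f (-L d j)))) := by
  simp only [semi_update, opSubst_add]
  congr 1
  simp only [opSubst_smul, ρ.aEval_opSubst _ _ hf]
  have hL' : ∀ i, PolyFun (prodCoords {id}) (fun p : ℂ × ℂ => L p.1 i) := fun i =>
    (hL i).comp (φ := Prod.fst) (by rintro _ rfl; exact .fst_coord rfl)
  congr 1
  rw [opSubst_opSubst ρ.DM (f := fun p : ℂ × ℂ =>
    aEval ρ.act (fun s => L p.1 (j.succAbove s)) (fun s => (x (j.succAbove s)).1)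
      (f (p.2 + ∑ s, L p.1 (j.succAbove s))))]
  · congr 1
    ext d
    have := hsum d
    rw [Fin.sum_univ_succAbove _ j] at this
    rw [show d + ∑ s, L d (j.succAbove s) = -L d j by linear_combination this]
  · refine ρ.polyFun_aEval (fun i => hL' _) _ (hf.comp
      (φ := fun p : ℂ × ℂ => p.2 + ∑ s, L p.1 (j.succAbove s)) ?_)
    rintro _ rfl
    exact PolyFun.snd_coord.add (.sum _ fun _ _ => hL' _)

end Basic

end ConfRep

section Filippov

variable {n : ℕ} {X : Type*}

theorem sum_succAbove_comm {Z : Type*} [AddCommMonoid Z] (f : Fin (n + 2) → Fin (n + 1) → Z) :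
    ∑ i, ∑ p, f i p = ∑ j : Fin (n + 2), ∑ q : Fin (n + 1), f (j.succAbove q) (q.predAbove j) := by
  simp only [← Finset.sum_product', Finset.univ_product_univ]
  refine Finset.sum_nbij' (fun x => (x.1.succAbove x.2, x.2.predAbove x.1))
    (fun x => (x.1.succAbove x.2, x.2.predAbove x.1)) (by simp) (by simp) ?_ ?_ ?_ <;>
  simp [Fin.succAbove_succAbove_predAbove, Fin.predAbove_predAbove_succAbove]

/-- The alternating sum of the values of an action with one slot moved to the module. -/
def altAct (F : (Fin n → X) → Module.End ℂ M) (z : Fin (n + 1) → X) (v : Fin (n + 1) → M) : M :=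
  ∑ i : Fin (n + 1), (-1 : ℂ) ^ (n - (i : ℕ)) • F (fun s => z (i.succAbove s)) (v i)

theorem altAct_snoc (F : (Fin (n + 1) → X) → Module.End ℂ M) (y : Fin (n + 1) → X) (a : X)
    (v : Fin (n + 1) → M) (t : M) :
    altAct F (Fin.snoc y a) (Fin.snoc v t)
      = ∑ p : Fin (n + 1), ((-1 : ℂ) ^ (n + 1) * (-1) ^ (p : ℕ)) •
          F (Fin.snoc (fun s => y (p.succAbove s)) a) (v p) + F y t := by
  rw [altAct, Fin.sum_univ_castSucc]
  simp only [Fin.snoc_castSucc, Fin.snoc_last, Fin.succAbove_last, Fin.val_last, Nat.sub_self,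
    pow_zero, one_smul]
  congr 1
  refine Finset.sum_congr rfl fun p _ => ?_
  rw [ConfRep.neg_one_pow_sub]
  congr 3
  ext s
  refine Fin.lastCases ?_ (fun s => ?_) s
  · simp
  · simp [Fin.castSucc_succAbove_castSucc]

theorem altAct_cons (F : (Fin (n + 1) → X) → Module.End ℂ M) (y : Fin (n + 1) → X) (a : X)
    (v : Fin (n + 1) → M) (t : M) :
    altAct F (Fin.cons a y) (Fin.cons t v)
      = (-1 : ℂ) ^ (n + 1) • F y t + ∑ q : Fin (n + 1), ((-1 : ℂ) ^ (n + 1) * -(-1) ^ (q : ℕ)) •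
          F (Fin.cons a (fun s => y (q.succAbove s))) (v q) := by
  rw [altAct, Fin.sum_univ_succ]
  simp only [Fin.cons_zero, Fin.cons_succ, Fin.succAbove_zero, Fin.val_zero, Nat.sub_zero]
  congr 1
  refine Finset.sum_congr rfl fun q _ => ?_
  rw [ConfRep.neg_one_pow_sub, Fin.val_succ, pow_succ _ (q : ℕ), mul_neg_one]
  congr 3
  ext s
  refine Fin.cases ?_ (fun s => ?_) s
  · simp
  · simp [Fin.succ_succAbove_succ]

/-- The Filippov identity for the alternating sums of an alternating action. -/
theorem altAct_filippov (F : (Fin (n + 1) → X) → Module.End ℂ M) (B : (Fin (n + 2) → X) → X)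
    (hF : ∀ (σ : Equiv.Perm (Fin (n + 1))) y v,
      F (y ∘ σ) v = ((Equiv.Perm.sign σ : ℤ) : ℂ) • F y v)
    (hB : ∀ (y : Fin (n + 1) → X) p v (σ : Equiv.Perm (Fin (n + 2))) z,
      F (Function.update y p (B (z ∘ σ))) v
        = ((Equiv.Perm.sign σ : ℤ) : ℂ) • F (Function.update y p (B z)) v)
    (h₁ : ∀ z y v, ∑ i : Fin (n + 2), (-1 : ℂ) ^ (n + 1 - (i : ℕ)) •
        F (fun s => z (i.succAbove s)) (F (Function.update y 0 (z i)) v)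
          = F (Function.update y 0 (B z)) v)
    (h₂ : ∀ y y' v, F y (F y' v) - F y' (F y v)
      = ∑ i : Fin (n + 1), F (Function.update y' i (B (Fin.snoc y (y' i)))) v)
    (z : Fin (n + 2) → X) (v : Fin (n + 2) → M) (w : Fin (n + 1) → X) (u : Fin (n + 1) → M) :
    ∑ i : Fin (n + 2), (-1 : ℂ) ^ (n + 1 - (i : ℕ)) •
        altAct F (Fin.snoc (fun s => z (i.succAbove s)) (B (Fin.cons (z i) w)))
          (Fin.snoc (fun s => v (i.succAbove s)) (altAct F (Fin.cons (z i) w) (Fin.cons (v i) u)))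
      = altAct F (Fin.cons (B z) w) (Fin.cons (altAct F z v) u) := by
  have hu : ∀ q : Fin (n + 1), ∑ i : Fin (n + 2), (-1 : ℂ) ^ (n + 1 - (i : ℕ)) •
      F (fun s => z (i.succAbove s)) (F (Fin.cons (z i) fun s => w (q.succAbove s)) (u q))
        = F (Fin.cons (B z) fun s => w (q.succAbove s)) (u q) := by
    intro q
    simpa only [Fin.update_cons_zero] using
      h₁ z (Fin.cons (z 0) fun s => w (q.succAbove s)) (u q)
  have hv : ∑ i : Fin (n + 2), ∑ p : Fin (n + 1),
      ((-1 : ℂ) ^ (i : ℕ) * (-1) ^ (p : ℕ)) •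
        F (Fin.snoc (fun s => z (i.succAbove (p.succAbove s))) (B (Fin.cons (z i) w)))
          (v (i.succAbove p))
      = ∑ j : Fin (n + 2), (-1 : ℂ) ^ (j : ℕ) • (F w (F (fun s => z (j.succAbove s)) (v j)) -
          F (fun s => z (j.succAbove s)) (F w (v j))) := by
    rw [sum_succAbove_comm]
    refine Finset.sum_congr rfl fun j _ => ?_
    rw [h₂, Finset.smul_sum]
    refine Finset.sum_congr rfl fun q _ => ?_
    have e₁ := apply_snoc_succAbove (fun y => F y (v j)) (fun σ y => hF σ y (v j))
      (fun s => z (j.succAbove s)) q (B (Fin.cons (z (j.succAbove q)) w))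
    have e₂ := apply_snoc_eq_apply_cons
      (fun y => F (Function.update (fun s => z (j.succAbove s)) q (B y)) (v j))
      (hB _ _ _) w (z (j.succAbove q))
    rw [← pow_add, Fin.neg_one_pow_succAbove_add_predAbove]
    simp only [Fin.succAbove_succAbove_predAbove, Fin.succAbove_succAbove_succAbove_predAbove]
    rw [e₁, e₂]
    simp only [smul_smul]
    congr 1
    rw [pow_add, pow_succ]
    have h1 : ((-1 : ℂ) ^ (q : ℕ)) ^ 2 = 1 := by rw [← pow_mul, mul_comm, pow_mul]; simp
    linear_combination (-(-1 : ℂ) ^ (j : ℕ)) * (-1 : ℂ) ^ n * h1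
  have he : (-1 : ℂ) ^ (n + 1) * (-1) ^ (n + 1) = 1 := by rw [← mul_pow]; simp
  have hE : ∑ i : Fin (n + 2), (-1 : ℂ) ^ (n + 1 - (i : ℕ)) •
      (F (fun s => z (i.succAbove s))) (altAct F (Fin.cons (z i) w) (Fin.cons (v i) u))
      = ∑ i : Fin (n + 2), (-1 : ℂ) ^ (i : ℕ) • F (fun s => z (i.succAbove s)) (F w (v i))
        + ∑ q : Fin (n + 1), ((-1 : ℂ) ^ (n + 1) * -(-1) ^ (q : ℕ)) •
          F (Fin.cons (B z) (fun s => w (q.succAbove s))) (u q) := by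
    simp only [altAct_cons, map_add, map_sum, map_smul, smul_add, Finset.sum_add_distrib, ← hu,
      Finset.smul_sum]
    congr 1
    · refine Finset.sum_congr rfl fun i _ => ?_
      rw [smul_smul, ConfRep.neg_one_pow_sub, mul_right_comm, he, one_mul]
    · rw [Finset.sum_comm]
      simp only [smul_comm ((-1 : ℂ) ^ (n + 1 - _))]
  simp only [altAct_snoc, smul_add, Finset.sum_add_distrib]
  rw [hE, altAct_cons, ← add_assoc]
  congr 1
  have hL : ∀ i : Fin (n + 2), (-1 : ℂ) ^ (n + 1 - (i : ℕ)) • ∑ p : Fin (n + 1),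
      ((-1 : ℂ) ^ (n + 1) * (-1) ^ (p : ℕ)) •
        F (Fin.snoc (fun s => z (i.succAbove (p.succAbove s))) (B (Fin.cons (z i) w)))
          (v (i.succAbove p))
      = ∑ p : Fin (n + 1), ((-1 : ℂ) ^ (i : ℕ) * (-1) ^ (p : ℕ)) •
        F (Fin.snoc (fun s => z (i.succAbove (p.succAbove s))) (B (Fin.cons (z i) w)))
          (v (i.succAbove p)) := by
    intro i
    rw [Finset.smul_sum]
    refine Finset.sum_congr rfl fun p _ => ?_
    rw [smul_smul, ConfRep.neg_one_pow_sub, mul_mul_mul_comm, he, one_mul]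
  simp only [hL, hv]
  rw [← Finset.sum_add_distrib, altAct, map_sum, Finset.smul_sum]
  refine Finset.sum_congr rfl fun j _ => ?_
  rw [← smul_add, sub_add_cancel, map_smul, smul_smul, ConfRep.neg_one_pow_sub, ← mul_assoc, he,
    one_mul]

end Filippov

namespace ConfRep

theorem snoc_map₂ {n : ℕ} {P Q Y : Type*} (g : P → Q → Y) (a : Fin n → P) (u : P) (b : Fin n → Q)
    (w : Q) :
    (fun t => g ((Fin.snoc a u : Fin (n + 1) → P) t) ((Fin.snoc b w : Fin (n + 1) → Q) t))
      = Fin.snoc (fun t => g (a t) (b t)) (g u w) := by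
  ext t
  refine Fin.lastCases ?_ (fun t => ?_) t <;> simp

theorem cons_map₂ {n : ℕ} {P Q Y : Type*} (g : P → Q → Y) (a : Fin n → P) (u : P) (b : Fin n → Q)
    (w : Q) :
    (fun t => g ((Fin.cons u a : Fin (n + 1) → P) t) ((Fin.cons w b : Fin (n + 1) → Q) t))
      = Fin.cons (g u w) (fun t => g (a t) (b t)) := by
  ext t
  refine Fin.cases ?_ (fun t => ?_) t <;> simp

section Filippov

variable {A : NLieConfAlg m R} (ρ : ConfRep m A M)

/-- The action as a function of arguments paired with their weights. -/
def pairAct (y : Fin m → ℂ × R) : Module.End ℂ M :=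
  ρ.evalMap (fun t => (y t).1) fun t => (y t).2

theorem semi_eq_altAct (L : Fin (m + 1) → ℂ) (x : Fin (m + 1) → R × M) :
    ρ.semi L x = altAct ρ.pairAct (fun i => (L i, (x i).1)) (fun i => (x i).2) := rfl

theorem semi_snoc_eq (L : Fin m → ℂ) (w : ℂ) (x : Fin m → R × M) (u : R × M) :
    ρ.semi (Fin.snoc L w) (Fin.snoc x u)
      = altAct ρ.pairAct (Fin.snoc (fun i => (L i, (x i).1)) (w, u.1))
          (Fin.snoc (fun i => (x i).2) u.2) := by
  have h₁ := snoc_map₂ (fun p (q : R × M) => (p, q.1)) L w x u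
  have h₂ := snoc_map₂ (fun _ (q : R × M) => q.2) L w x u
  rw [semi_eq_altAct, h₁, h₂]

theorem semi_cons_eq (L : Fin m → ℂ) (w : ℂ) (x : Fin m → R × M) (u : R × M) :
    ρ.semi (Fin.cons w L) (Fin.cons u x)
      = altAct ρ.pairAct (Fin.cons (w, u.1) (fun i => (L i, (x i).1)))
          (Fin.cons u.2 (fun i => (x i).2)) := by
  have h₁ := cons_map₂ (fun p (q : R × M) => (p, q.1)) L w x u
  have h₂ := cons_map₂ (fun _ (q : R × M) => q.2) L w x u
  rw [semi_eq_altAct, h₁, h₂]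

/-- The bracket of arguments paired with their weights, carrying the total weight. -/
def pairBracket (A : NLieConfAlg m R) (y : Fin (m + 1) → ℂ × R) : ℂ × R :=
  (∑ i, (y i).1, pEval A.prodl (fun s => (y s.castSucc).1) fun i => (y i).2)

theorem pairAct_update (y : Fin m → ℂ × R) (p : Fin m) (u : ℂ × R) :
    ρ.pairAct (Function.update y p u)
      = ρ.evalMap (Function.update (fun t => (y t).1) p u.1)
          (Function.update (fun t => (y t).2) p u.2) := by
  have h₁ : (fun t => (Function.update y p u t).1) = Function.update (fun t => (y t).1) p u.1 := by
    ext t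
    exact Function.apply_update (fun _ (q : ℂ × R) => q.1) y p u t
  have h₂ : (fun t => (Function.update y p u t).2) = Function.update (fun t => (y t).2) p u.2 := by
    ext t
    exact Function.apply_update (fun _ (q : ℂ × R) => q.2) y p u t
  rw [pairAct, h₁, h₂]

theorem pairBracket_cons (A : NLieConfAlg m R) (y : Fin m → ℂ × R) (u : ℂ × R) :
    pairBracket A (Fin.cons u y) = (u.1 + ∑ i, (y i).1,
      pEval A.prodl (fun s => (Fin.cons u.1 (fun i => (y i).1) : Fin (m + 1) → ℂ) s.castSucc)
        (Fin.cons u.2 fun i => (y i).2)) := by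
  rw [pairBracket, Fin.sum_univ_succ]
  congr 2
  · ext s
    exact congrFun (cons_map₂ (fun _ (q : ℂ × R) => q.1) y u y u) s.castSucc
  · exact cons_map₂ (fun _ (q : ℂ × R) => q.2) y u y u

theorem pairBracket_snoc (A : NLieConfAlg m R) (y : Fin m → ℂ × R) (u : ℂ × R) :
    pairBracket A (Fin.snoc y u) = ((∑ i, (y i).1) + u.1,
      pEval A.prodl (fun i => (y i).1) (Fin.snoc (fun i => (y i).2) u.2)) := by
  rw [pairBracket, Fin.sum_univ_castSucc]
  simp only [Fin.snoc_castSucc, Fin.snoc_last]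
  congr 2
  exact snoc_map₂ (fun _ (q : ℂ × R) => q.2) y u y u

theorem semi_filippov (lam : Fin (m + 1) → ℂ) (β : Fin m → ℂ) (a : Fin (m + 1) → R × M)
    (b : Fin m → R × M) :
    ∑ i : Fin (m + 1), (-1 : ℂ) ^ (m - (i : ℕ)) •
        ρ.semi (Fin.snoc (fun s => lam (i.succAbove s)) (lam i + ∑ s, β s))
          (Fin.snoc (fun s => a (i.succAbove s))
            (pEval A.prodl (fun s => (Fin.cons (lam i) β : Fin (m + 1) → ℂ) s.castSucc)
              (Fin.cons (a i).1 fun s => (b s).1),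
              ρ.semi (Fin.cons (lam i) β) (Fin.cons (a i) b)))
      = ρ.semi (Fin.cons (∑ i, lam i) β)
          (Fin.cons (pEval A.prodl (fun s => lam s.castSucc) (fun s => (a s).1), ρ.semi lam a)
            b) := by
  obtain ⟨n, rfl⟩ : ∃ n, m = n + 1 := Nat.exists_eq_succ_of_ne_zero (NeZero.ne m)
  have key := altAct_filippov ρ.pairAct (pairBracket A)
    (fun σ y v => ρ.aEval_comp_perm v σ y) ?_ ?_ ?_ (fun i => (lam i, (a i).1))
    (fun i => (a i).2) (fun i => (β i, (b i).1)) (fun i => (b i).2)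
  · simp only [semi_snoc_eq, semi_cons_eq]
    simp only [pairBracket_cons] at key
    exact key
  · intro y p v σ z
    rw [pairAct_update, pairAct_update]
    have := ρ.aEval_bracket_comp_perm (fun t => (y t).1) (fun t => (y t).2) p v σ z
    simpa only [pairBracket, Function.comp_apply, Equiv.sum_comp σ (fun i => (z i).1),
      aEval_eq_evalMap] using this
  · intro z y v
    have := ρ.filippov1 (fun i => (z i).1) (fun i => (y i).1) (fun i => (z i).2)
      (fun i => (y i).2) v
    simp only [pairAct_update]
    exact this
  · intro y y' v
    have := ρ.filippov2 (fun i => (y i).1) (fun i => (y' i).1) (fun i => (y i).2)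
      (fun i => (y' i).2) v
    simp only [pairAct_update, pairBracket_snoc]
    exact this

end Filippov

end ConfRep

theorem exists_forall_le_of_finset {n : ℕ} {P : Type*} [Zero P] {p : (Fin n → ℕ) → P}
    {S : Finset (Fin n → ℕ)} (hS : ∀ k, k ∉ S → p k = 0) :
    ∃ N : ℕ, ∀ k : Fin n → ℕ, N ≤ ∑ s, k s → p k = 0 := by
  refine ⟨S.sup (fun k => ∑ s, k s) + 1, fun k hk => hS k fun h => ?_⟩
  have := Finset.le_sup (f := fun k : Fin n → ℕ => ∑ s, k s) h
  omega

theorem map_neg_add_smul_pow {N : Type*} [AddCommGroup N] [Module ℂ N] {D : Module.End ℂ M}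
    {D' : Module.End ℂ N} (T : M →ₗ[ℂ] N) (hT : ∀ w, T (D w) = D' (T w)) (c : ℂ) (j : ℕ) (w : M) :
    T (((-(D + c • (1 : Module.End ℂ M))) ^ j) w)
      = ((-(D' + c • (1 : Module.End ℂ N))) ^ j) (T w) := by
  induction j generalizing w with
  | zero => simp
  | succ j ih =>
    rw [pow_succ, pow_succ, Module.End.mul_apply, Module.End.mul_apply, ih]
    simp [hT]

namespace ConfRep

theorem fst_update {n : ℕ} {P Q : Type*} (x : Fin n → P × Q) (j : Fin n) (u : P × Q) :
    (fun t => (Function.update x j u t).1) = Function.update (fun t => (x t).1) j u.1 := by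
  ext t
  exact Function.apply_update (fun _ (q : P × Q) => q.1) x j u t

theorem fst_snoc {n : ℕ} {P Q : Type*} (x : Fin n → P × Q) (u : P × Q) :
    (fun t => ((Fin.snoc x u : Fin (n + 1) → P × Q) t).1) = Fin.snoc (fun t => (x t).1) u.1 :=
  snoc_map₂ (fun _ (q : P × Q) => q.1) x u x u

theorem fst_cons {n : ℕ} {P Q : Type*} (x : Fin n → P × Q) (u : P × Q) :
    (fun t => ((Fin.cons u x : Fin (n + 1) → P × Q) t).1) = Fin.cons u.1 (fun t => (x t).1) :=
  cons_map₂ (fun _ (q : P × Q) => q.1) x u x u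

section Semidirect

variable {A : NLieConfAlg m R} (ρ : ConfRep m A M)

theorem sum_snoc_sub {n : ℕ} (lam : Fin n → ℂ) (d : ℂ) :
    ∑ i, (Fin.snoc lam (-d - ∑ s, lam s) : Fin (n + 1) → ℂ) i = -d := by
  simp [Fin.sum_univ_castSucc]

theorem polyFun_neg_sub (c : ℂ) : PolyFun {id} (fun d : ℂ => -d - c) :=
  (PolyFun.coord (Set.mem_singleton id)).neg.sub (.const c)

theorem polyFun_snoc_sub {n : ℕ} (lam : Fin n → ℂ) (i : Fin (n + 1)) :
    PolyFun {id} (fun d : ℂ => (Fin.snoc lam (-d - ∑ s, lam s) : Fin (n + 1) → ℂ) i) :=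
  polyFun_snoc (fun s => .const (lam s)) (polyFun_neg_sub _) i

theorem polyFun_semi_prod {X : Type*} {S : Set (X → ℂ)} {L : X → Fin m → ℂ}
    (hL : ∀ i, PolyFun S (fun x => L x i)) (x : Fin (m + 1) → R × M) :
    PolyFun (prodCoords S) (fun p : X × ℂ =>
      ρ.semi (Fin.snoc (L p.1) (-p.2 - ∑ s, L p.1 s)) x) := by
  have hL' : ∀ i, PolyFun (prodCoords S) (fun p : X × ℂ => L p.1 i) := fun i =>
    (hL i).comp (φ := Prod.fst) fun s hs => .fst_coord hs
  exact ρ.polyFun_semi (polyFun_snoc hL' (PolyFun.snd_coord.neg.sub (.sum _ fun s _ => hL' s))) x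

theorem polyFun_semiBracket (x : Fin (m + 1) → R × M) :
    PolyFun (piCoords (Fin m)) (fun lam => ρ.semiBracket lam x) :=
  (ρ.polyFun_semi_prod (L := fun lam : Fin m → ℂ => lam)
    (fun i => .coord (S := piCoords (Fin m)) ⟨i, rfl⟩) x).opSubst ρ.DM

/-- The modes of the semidirect bracket. -/
def semidirectProd (k : Fin m → ℕ) :
    MultilinearMap ℂ (fun _ : Fin (m + 1) => R × M) (R × M) :=
  ((A.prodl k).compLinearMap fun _ => LinearMap.fst ℂ R M).prod
    (MultilinearMap.mk' (fun x => dPowCoeff (Fin m) M (fun lam => ρ.semiBracket lam x) k)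
      (fun x i u v => by
        have : (fun lam => ρ.semiBracket lam (Function.update x i (u + v)))
            = (fun lam => ρ.semiBracket lam (Function.update x i u))
              + (fun lam => ρ.semiBracket lam (Function.update x i v)) := by
          ext lam
          simp only [semiBracket, semi_update_add, opSubst_add, Pi.add_apply]
        rw [this, map_add, Finsupp.add_apply])
      (fun x i c u => by
        have : (fun lam => ρ.semiBracket lam (Function.update x i (c • u)))
            = c • (fun lam => ρ.semiBracket lam (Function.update x i u)) := by
          ext lam
          simp only [semiBracket, semi_update_smul, opSubst_smul, Pi.smul_apply]
        rw [this, map_smul, Finsupp.smul_apply]))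

theorem semidirectProd_apply (k : Fin m → ℕ) (x : Fin (m + 1) → R × M) :
    ρ.semidirectProd k x = (A.prodl k (fun i => (x i).1),
      dPowCoeff (Fin m) M (fun lam => ρ.semiBracket lam x) k) := rfl

theorem exists_finset_semidirectProd (x : Fin (m + 1) → R × M) :
    ∃ S : Finset (Fin m → ℕ), ∀ k, k ∉ S → ρ.semidirectProd k x = 0 := by
  classical
  obtain ⟨S, hS⟩ := exists_finset_of_locFin (A.locFin fun i => (x i).1)
  refine ⟨S ∪ (dPowCoeff (Fin m) M (fun lam => ρ.semiBracket lam x)).support, fun k hk => ?_⟩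
  simp only [Finset.mem_union, Finsupp.mem_support_iff, not_or, not_not] at hk
  rw [semidirectProd_apply, hS k hk.1, hk.2, Prod.mk_zero_zero]

theorem finsum_dPowCoeff_semiBracket (lam : Fin m → ℂ) (x : Fin (m + 1) → R × M) :
    ∑ᶠ k : Fin m → ℕ, (∏ s, dPow (lam s) (k s)) •
        dPowCoeff (Fin m) M (fun lam => ρ.semiBracket lam x) k = ρ.semiBracket lam x := by
  conv_rhs => rw [← congrFun (dPowSum_dPowCoeff (ρ.polyFun_semiBracket x)) lam, dPowSum_apply]
  exact finsum_eq_sum_of_forall_notMem (fun k hk => Finsupp.notMem_support_iff.1 hk)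
    fun k hk => by rw [hk, smul_zero]

theorem pEval_semidirectProd (lam : Fin m → ℂ) (x : Fin (m + 1) → R × M) :
    pEval ρ.semidirectProd lam x
      = (pEval A.prodl lam (fun i => (x i).1), ρ.semiBracket lam x) := by
  obtain ⟨S, hS⟩ := ρ.exists_finset_semidirectProd x
  have h₁ : ∀ k, k ∉ S → A.prodl k (fun i => (x i).1) = 0 := fun k hk => congrArg Prod.fst (hS k hk)
  have h₂ : ∀ k, k ∉ S → dPowCoeff (Fin m) M (fun lam => ρ.semiBracket lam x) k = 0 :=
    fun k hk => congrArg Prod.snd (hS k hk)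
  rw [← ρ.finsum_dPowCoeff_semiBracket lam x, pEval, pEval,
    finsum_eq_sum_of_forall_notMem hS fun k hk => by rw [hk, smul_zero],
    finsum_eq_sum_of_forall_notMem h₁ fun k hk => by rw [hk, smul_zero],
    finsum_eq_sum_of_forall_notMem h₂ fun k hk => by rw [hk, smul_zero]]
  ext <;> simp [Prod.fst_sum, Prod.snd_sum, semidirectProd_apply]

theorem pEvalOp_semidirectProd (lam : Fin m → ℂ) (c : ℂ) (x : Fin (m + 1) → R × M) :
    pEvalOp (LinearMap.prodMap A.D ρ.DM) ρ.semidirectProd lam c x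
      = (pEvalOp A.D A.prodl lam c (fun i => (x i).1),
        opSubst ρ.DM fun d =>
          ρ.semiBracket (Function.update lam (lastIdx m) (-d - c)) x) := by
  obtain ⟨S, hS⟩ := ρ.exists_finset_semidirectProd x
  have h₁ : ∀ k, k ∉ S → A.prodl k (fun i => (x i).1) = 0 := fun k hk => congrArg Prod.fst (hS k hk)
  have h₂ : ∀ k, k ∉ S → dPowCoeff (Fin m) M (fun lam => ρ.semiBracket lam x) k = 0 :=
    fun k hk => congrArg Prod.snd (hS k hk)
  have h₃ := finsum_op_eq_opSubst (D := ρ.DM) lam c h₂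
  simp only [finsum_dPowCoeff_semiBracket] at h₃
  rw [← h₃, pEvalOp, pEvalOp,
    finsum_eq_sum_of_forall_notMem hS fun k hk => by simp only [hk, map_zero, smul_zero],
    finsum_eq_sum_of_forall_notMem h₁ fun k hk => by simp only [hk, map_zero, smul_zero],
    finsum_eq_sum_of_forall_notMem h₂ fun k hk => by simp only [hk, map_zero, smul_zero]]
  have e₁ := map_neg_add_smul_pow (D := LinearMap.prodMap A.D ρ.DM) (D' := A.D)
    (LinearMap.fst ℂ R M) (fun _ => rfl) c
  have e₂ := map_neg_add_smul_pow (D := LinearMap.prodMap A.D ρ.DM) (D' := ρ.DM)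
    (LinearMap.snd ℂ R M) (fun _ => rfl) c
  simp only [LinearMap.fst_apply, LinearMap.snd_apply] at e₁ e₂
  ext
  · simp only [Prod.fst_sum, Prod.smul_fst, e₁, semidirectProd_apply]
  · simp only [Prod.snd_sum, Prod.smul_snd, e₂, semidirectProd_apply]

theorem semiBracket_update_D (lam : Fin m → ℂ) (x : Fin (m + 1) → R × M) (j : Fin (m + 1)) :
    ρ.semiBracket lam (Function.update x j (A.D (x j).1, ρ.DM (x j).2))
      = opSubst ρ.DM fun d => -((Fin.snoc lam (-d - ∑ s, lam s) : Fin (m + 1) → ℂ) j) •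
          ρ.semi (Fin.snoc lam (-d - ∑ s, lam s)) x := by
  let T (d : ℂ) : M := (-1 : ℂ) ^ (m - (j : ℕ)) • aEval ρ.act
    (fun s => (Fin.snoc lam (-d - ∑ s, lam s) : Fin (m + 1) → ℂ) (j.succAbove s))
    (fun s => (x (j.succAbove s)).1) (x j).2
  have hT : PolyFun {id} T :=
    PolyFun.smul (.const _) (ρ.polyFun_aEval (fun s => polyFun_snoc_sub lam _) _ (.const _))
  have h0 := map_opSubst ρ.DM ρ.DM ρ.DM 0 (fun w => by simp) hT
  simp only [add_zero] at h0
  have h (d : ℂ) : ρ.semi (Fin.snoc lam (-d - ∑ s, lam s))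
        (Function.update x j (A.D (x j).1, ρ.DM (x j).2))
      = (ρ.DM (T d) + -(d • T d)) + -((Fin.snoc lam (-d - ∑ s, lam s) : Fin (m + 1) → ℂ) j) •
          ρ.semi (Fin.snoc lam (-d - ∑ s, lam s)) x := by
    rw [semi_update_D, sum_snoc_sub, neg_smul, neg_smul, ← sub_eq_add_neg, ← sub_eq_add_neg]
  simp only [semiBracket, h, opSubst_add, opSubst_neg, opSubst_mul _ hT, ← h0]
  rw [add_neg_cancel, zero_add]

theorem semiBracket_sesq (lam : Fin m → ℂ) (x : Fin (m + 1) → R × M) (i : Fin m) :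
    ρ.semiBracket lam (Function.update x i.castSucc (A.D (x i.castSucc).1, ρ.DM (x i.castSucc).2))
      = -(lam i) • ρ.semiBracket lam x := by
  simp only [semiBracket_update_D, Fin.snoc_castSucc, opSubst_smul]
  rfl

theorem semiBracket_sesqLast (lam : Fin m → ℂ) (x : Fin (m + 1) → R × M) :
    ρ.semiBracket lam
        (Function.update x (Fin.last m) (A.D (x (Fin.last m)).1, ρ.DM (x (Fin.last m)).2))
      = ρ.DM (ρ.semiBracket lam x) + (∑ s, lam s) • ρ.semiBracket lam x := by
  simp only [semiBracket_update_D, Fin.snoc_last, neg_sub, sub_neg_eq_add, add_smul, opSubst_add,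
    opSubst_smul, opSubst_mul _ (ρ.polyFun_semi (polyFun_snoc_sub lam) x)]
  rw [add_comm]
  rfl

theorem semiBracket_skew (lam : Fin m → ℂ) (x : Fin (m + 1) → R × M) {i j : Fin m} (hij : i ≠ j) :
    ρ.semiBracket (fun t => lam (Equiv.swap i j t))
        (fun t => x (Equiv.swap i.castSucc j.castSucc t)) = -ρ.semiBracket lam x := by
  rw [semiBracket, semiBracket, ← opSubst_neg]
  congr 1
  ext d
  have h := ρ.semi_comp_perm (Fin.snoc lam (-d - ∑ s, lam s)) x (Equiv.swap i.castSucc j.castSucc)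
  rw [Equiv.Perm.sign_swap ((Fin.castSucc_injective m).ne hij)] at h
  simp only [Units.val_neg, Units.val_one, Int.cast_neg, Int.cast_one, neg_smul, one_smul] at h
  rw [← h, Equiv.sum_comp (Equiv.swap i j) lam]
  congr 1
  ext t
  refine Fin.lastCases ?_ (fun t => ?_) t
  · rw [Equiv.swap_apply_of_ne_of_ne (Fin.castSucc_lt_last i).ne' (Fin.castSucc_lt_last j).ne']
    simp
  · rw [← (Fin.castSucc_injective m).map_swap]
    simp

theorem opSubst_semiBracket_swap (lam : Fin m → ℂ) (x : Fin (m + 1) → R × M) :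
    (opSubst ρ.DM fun e => ρ.semiBracket (Function.update lam (lastIdx m) (-e - ∑ s, lam s))
      (fun t => x (Equiv.swap (Fin.castSucc (lastIdx m)) (Fin.last m) t)))
        = -ρ.semiBracket lam x := by
  simp only [semiBracket]
  rw [opSubst_opSubst ρ.DM (f := fun p : ℂ × ℂ => ρ.semi
    (Fin.snoc (Function.update lam (lastIdx m) (-p.1 - ∑ s, lam s))
      (-p.2 - ∑ s, Function.update lam (lastIdx m) (-p.1 - ∑ s, lam s) s))
    (fun t => x (Equiv.swap (Fin.castSucc (lastIdx m)) (Fin.last m) t))), ← opSubst_neg]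
  · congr 1
    ext d
    have h := ρ.semi_comp_perm (Fin.snoc lam (-d - ∑ s, lam s)) x
      (Equiv.swap (Fin.castSucc (lastIdx m)) (Fin.last m))
    rw [Equiv.Perm.sign_swap (Fin.castSucc_lt_last _).ne] at h
    simp only [Units.val_neg, Units.val_one, Int.cast_neg, Int.cast_one, neg_smul, one_smul] at h
    rw [← h]
    congr 1
    ext t
    refine Fin.lastCases ?_ (fun t => ?_) t
    · rw [Equiv.swap_apply_right, Fin.snoc_last, Fin.snoc_castSucc,
        Finset.sum_update_of_mem (Finset.mem_univ _), ← Finset.erase_eq,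
        ← Finset.add_sum_erase _ _ (Finset.mem_univ (lastIdx m))]
      ring
    · by_cases ht : t = lastIdx m
      · subst ht
        simp
      · rw [Equiv.swap_apply_of_ne_of_ne (fun h => ht (Fin.castSucc_injective _ h))
          (Fin.castSucc_lt_last t).ne]
        simp [ht]
  · refine ρ.polyFun_semi_prod
      (L := fun e : ℂ => Function.update lam (lastIdx m) (-e - ∑ s, lam s)) (fun i => ?_) _
    by_cases hi : i = lastIdx m
    · subst hi
      simpa only [Function.update_self] using polyFun_neg_sub _
    · simpa only [Function.update_of_ne hi] using .const _

theorem semiBracket_update_semiBracket (lam mu : Fin m → ℂ) (x y : Fin (m + 1) → R × M)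
    (j : Fin (m + 1)) (r : R) :
    ρ.semiBracket lam (Function.update x j (r, ρ.semiBracket mu y))
      = opSubst ρ.DM fun d => ρ.semi (Fin.snoc lam (-d - ∑ s, lam s)) (Function.update x j
          (r, ρ.semi (Fin.snoc mu ((Fin.snoc lam (-d - ∑ s, lam s) : Fin (m + 1) → ℂ) j
            - ∑ s, mu s)) y)) := by
  have := ρ.opSubst_semi_update_opSubst (polyFun_snoc_sub lam) (sum_snoc_sub lam) x j r
    (ρ.polyFun_semi (polyFun_snoc_sub mu) y)
  simp only [neg_neg] at this
  exact this

theorem semiBracket_filippov (lam : Fin (m + 1) → ℂ) (mus : Fin m → ℂ)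
    (a : Fin (m + 1) → R × M) (b : Fin m → R × M) :
    ∑ i : Fin (m + 1), (-1 : ℂ) ^ (m - (i : ℕ)) •
        ρ.semiBracket (fun s => lam (i.succAbove s))
          (Fin.snoc (fun s => a (i.succAbove s))
            (pEval A.prodl (Function.update mus 0 (lam i)) (Fin.cons (a i).1 fun s => (b s).1),
              ρ.semiBracket (Function.update mus 0 (lam i)) (Fin.cons (a i) b)))
      = ρ.semiBracket (Function.update mus 0 (∑ i, lam i))
          (Fin.cons (pEval A.prodl (fun s => lam s.castSucc) (fun s => (a s).1),
            ρ.semiBracket (fun s => lam s.castSucc) a) b) := by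
  obtain ⟨n, rfl⟩ : ∃ n, m = n + 1 := Nat.exists_eq_succ_of_ne_zero (NeZero.ne m)
  obtain ⟨c, τ, rfl⟩ : ∃ c τ, mus = Fin.cons c τ := ⟨mus 0, Fin.tail mus, (Fin.cons_self_tail _).symm⟩
  simp only [Fin.update_cons_zero]
  have hsnoc (i : Fin (n + 2)) (r : R) (mu : Fin (n + 1) → ℂ) (y : Fin (n + 2) → R × M) := by
    simpa only [Fin.update_snoc_last] using
      ρ.semiBracket_update_semiBracket (fun s => lam (i.succAbove s)) mu
        (Fin.snoc (fun s => a (i.succAbove s)) 0) y (Fin.last _) r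
  have hcons (L mu : Fin (n + 1) → ℂ) (y : Fin (n + 2) → R × M) (r : R) := by
    simpa only [Fin.update_cons_zero] using
      ρ.semiBracket_update_semiBracket L mu (Fin.cons 0 b) y 0 r
  simp only [hcons, hsnoc, ← opSubst_smul, ← opSubst_sum]
  congr 1
  ext d
  set ν := -d - ∑ i, lam i - ∑ s, τ s with hν
  have key := ρ.semi_filippov lam (Fin.snoc τ ν) a b
  have hlast : ∑ i, lam i - ∑ s : Fin (n + 1), lam s.castSucc = lam (Fin.last _) := by
    rw [Fin.sum_univ_castSucc]
    ring
  have hlam : (Fin.snoc (fun s : Fin (n + 1) => lam s.castSucc) (lam (Fin.last _)) :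
      Fin (n + 2) → ℂ) = lam := Fin.snoc_init_self lam
  have hβ : -d - (∑ i, lam i + ∑ s, τ s) = ν := by rw [hν]; ring
  have hi (i : Fin (n + 2)) : -d - ∑ s, lam (i.succAbove s) - (lam i + ∑ s, τ s) = ν := by
    rw [hν, Fin.sum_univ_succAbove lam i]
    ring
  have hw (i : Fin (n + 2)) :
      lam i + ∑ s, (Fin.snoc τ ν : Fin (n + 1) → ℂ) s = -d - ∑ s, lam (i.succAbove s) := by
    rw [Fin.sum_snoc, hν, Fin.sum_univ_succAbove lam i]
    ring
  have hcs (u : ℂ) : (fun s : Fin (n + 1) =>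
      (Fin.cons u (Fin.snoc τ ν : Fin (n + 1) → ℂ) : Fin (n + 2) → ℂ) s.castSucc)
        = Fin.cons u τ := by
    ext s
    rw [Fin.cons_snoc_eq_snoc_cons, Fin.snoc_castSucc]
  simp only [Fin.snoc_last, Fin.sum_cons, hi, hβ, ← Fin.cons_snoc_eq_snoc_cons, Fin.cons_zero,
    hlast, hlam]
  simp only [hw, hcs] at key
  exact key

/-- The semidirect product of an `n`-Lie conformal algebra with a conformal representation. -/
def semidirect : NLieConfAlg m (R × M) where
  D := LinearMap.prodMap A.D ρ.DM
  prodl := ρ.semidirectProd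
  locFin x :=
    let ⟨_, hS⟩ := ρ.exists_finset_semidirectProd x
    exists_forall_le_of_finset hS
  sesq lam x i := by
    rw [pEval_semidirectProd, pEval_semidirectProd]
    refine Prod.ext ?_ (ρ.semiBracket_sesq lam x i)
    rw [fst_update]
    exact A.sesq lam (fun t => (x t).1) i
  sesqLast lam x := by
    rw [pEval_semidirectProd, pEval_semidirectProd]
    refine Prod.ext ?_ (ρ.semiBracket_sesqLast lam x)
    rw [fst_update]
    exact A.sesqLast lam (fun t => (x t).1)
  skew lam x i j hij := by
    rw [pEval_semidirectProd, pEval_semidirectProd]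
    exact Prod.ext (A.skew lam (fun t => (x t).1) i j hij) (ρ.semiBracket_skew lam x hij)
  skewLast lam x := by
    rw [pEval_semidirectProd, pEvalOp_semidirectProd, opSubst_semiBracket_swap]
    exact Prod.ext (A.skewLast lam fun t => (x t).1) (neg_neg _).symm
  filippov lam mus a b := by
    simp only [pEval_semidirectProd]
    refine Prod.ext ?_ ?_
    · simp only [Prod.fst_sum, Prod.smul_fst]
      have := A.filippov lam mus (fun i => (a i).1) (fun i => (b i).1)
      simpa only [fst_snoc, fst_cons] using this
    · simp only [Prod.snd_sum, Prod.smul_snd]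
      have := ρ.semiBracket_filippov lam mus a b
      simpa only [fst_cons] using this

theorem semiBracket_eq (lam : Fin m → ℂ) (x : Fin (m + 1) → R × M) :
    ρ.semiBracket lam x
      = (∑ i : Fin m, ((-1 : ℂ) ^ (m - (i : ℕ))) •
          aEvalOp ρ.DM ρ.act (lamRm lam i) (∑ s, lam s)
            (fun s => (x (i.castSucc.succAbove s)).1) ((x i.castSucc).2))
        + aEval ρ.act lam (fun s => (x s.castSucc).1) ((x (Fin.last m)).2) := by
  have h (i : Fin m) (w : ℂ) : Function.update (lamRm lam i) (lastIdx m) w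
      = fun s => (Fin.snoc lam w : Fin (m + 1) → ℂ) (i.castSucc.succAbove s) := by
    ext s
    by_cases hs : s = lastIdx m
    · subst hs
      have : i.castSucc.succAbove (lastIdx m) = Fin.last m := by
        have := NeZero.pos m
        have := i.is_lt
        rw [Fin.succAbove_of_le_castSucc]
        · ext
          simp only [lastIdx, Fin.val_succ, Fin.val_last]
          omega
        · rw [Fin.le_def]
          simp only [lastIdx, Fin.val_castSucc]
          omega
      rw [this, Function.update_self, Fin.snoc_last]
    · have hlt : (i.castSucc.succAbove s : ℕ) < m := by
        have : (s : ℕ) ≠ m - 1 := fun h => hs (Fin.ext h)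
        have := s.is_lt
        simp only [Fin.succAbove, Fin.lt_def]
        split_ifs
        · exact s.is_lt
        · rw [Fin.val_succ]
          omega
      rw [Function.update_of_ne hs, lamRm, dif_pos hlt]
      exact (Fin.snoc_castSucc (α := fun _ => ℂ) w lam ⟨_, hlt⟩).symm
  simp only [semiBracket, semi, opSubst_sum, opSubst_smul, aEvalOp_eq_opSubst, h]
  rw [Fin.sum_univ_castSucc]
  simp only [Fin.val_castSucc, Fin.val_last, Nat.sub_self, pow_zero, one_smul, Fin.succAbove_last,
    Fin.snoc_castSucc, opSubst_const]

end Semidirect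

end ConfRep

/-- given a conformal representation `M` of the `n`-Lie conformal algebra
`R`, the `ℂ[∂]`-module `R ⊕ M` is an `n`-Lie conformal algebra under the semidirect
bracket `(14)`:
`[(a¹+v¹)_{λ₁}⋯(a^n+v^n)] = [a¹_{λ₁}⋯a^n]
  + Σ_{i=1}^{n-1}(−1)^{n−i} a¹⋯âⁱ⋯a^n_{−∂−Σλⱼ} vⁱ + a¹_{λ₁}⋯a^{n-1}_{λ_{n-1}} v^n`. -/
theorem stmt19 {m : ℕ} [NeZero m] {R : Type*} [AddCommGroup R] [Module ℂ R]
    {M : Type*} [AddCommGroup M] [Module ℂ M]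
    (A : NLieConfAlg m R) (ρ : ConfRep m A M) :
    ∃ B : NLieConfAlg m (R × M),
      B.D = (LinearMap.prodMap (A.D : R →ₗ[ℂ] R) (ρ.DM : M →ₗ[ℂ] M)) ∧
      ∀ (lam : Fin m → ℂ) (x : Fin (m + 1) → R × M),
        pEval B.prodl lam x
          = (pEval A.prodl lam (fun i => (x i).1),
             (∑ i : Fin m, ((-1 : ℂ) ^ (m - (i : ℕ))) •
                 aEvalOp ρ.DM ρ.act (lamRm lam i) (∑ s, lam s)
                   (fun s => (x (i.castSucc.succAbove s)).1) ((x i.castSucc).2))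
               + aEval ρ.act lam (fun s => (x s.castSucc).1) ((x (Fin.last m)).2)) := by
  exact ⟨ρ.semidirect, rfl, fun lam x => by
    rw [← ρ.semiBracket_eq]
    exact ρ.pEval_semidirectProd lam x⟩

end Rep
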